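/- arXiv:1902.05903 — 2 statements merged into one kernel-verified Lean document; each statement's English description precedes it below -/
import Mathlib

section
/- For every fixed integer r ≥ 3 there exists a constant c > 0 (depending only on r) such that for every real d ≥ 2 and every linear r-graph H on n ≥ 1 vertices with average degree at most d (i.e., r·|E(H)| ≤ d·n), H has an independent set of size at least c · n · (log d / d)^{1/(r-1)}. -/
namespace DLR
open Finset

section Prob
variable {V κ : Type*} [Fintype V] [DecidableEq V] [Fintype κ]

/-- Expectation over a finite product space with weights. -/
noncomputable def Ex (wt : V → κ → ℝ) (f : (V → κ) → ℝ) : ℝ :=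
  ∑ ω : V → κ, (∏ v, wt v (ω v)) * f ω

theorem Ex_add (wt : V → κ → ℝ) (f g : (V → κ) → ℝ) :
    Ex wt (fun ω => f ω + g ω) = Ex wt f + Ex wt g := by
  simp only [Ex, mul_add, Finset.sum_add_distrib]

theorem Ex_sub (wt : V → κ → ℝ) (f g : (V → κ) → ℝ) :
    Ex wt (fun ω => f ω - g ω) = Ex wt f - Ex wt g := by
  simp only [Ex, mul_sub, Finset.sum_sub_distrib]

theorem Ex_smul (wt : V → κ → ℝ) (a : ℝ) (f : (V → κ) → ℝ) :
    Ex wt (fun ω => a * f ω) = a * Ex wt f := by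
  simp only [Ex, Finset.mul_sum]
  exact Finset.sum_congr rfl fun _ _ => by ring

theorem Ex_sum {ι : Type*} (wt : V → κ → ℝ) (s : Finset ι) (f : ι → (V → κ) → ℝ) :
    Ex wt (fun ω => ∑ i ∈ s, f i ω) = ∑ i ∈ s, Ex wt (f i) := by
  simp only [Ex, Finset.mul_sum]
  exact Finset.sum_comm

theorem Ex_mono {wt : V → κ → ℝ} (h0 : ∀ v b, 0 ≤ wt v b) {f g : (V → κ) → ℝ}
    (h : ∀ ω, f ω ≤ g ω) : Ex wt f ≤ Ex wt g := by
  unfold Ex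
  gcongr with ω
  · exact Finset.prod_nonneg fun v _ => h0 v _
  · exact h ω

theorem Ex_prod_single {wt : V → κ → ℝ} (h : V → κ → ℝ) :
    Ex wt (fun ω => ∏ v, h v (ω v)) = ∏ v, ∑ b, wt v b * h v b := by
  classical
  unfold Ex
  rw [Finset.prod_univ_sum]
  simp only [Fintype.piFinset_univ, Finset.prod_mul_distrib]

theorem Ex_const {wt : V → κ → ℝ} (h1 : ∀ v, ∑ b, wt v b = 1) (a : ℝ) :
    Ex wt (fun _ => a) = a := by
  have h := Ex_prod_single (wt := wt) (fun _ _ => 1)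
  simp only [Finset.prod_const_one, mul_one, h1] at h
  have := Ex_smul wt a (fun _ => 1)
  simp only [mul_one, h] at this
  exact this

theorem Ex_single {wt : V → κ → ℝ} (h1 : ∀ v, ∑ b, wt v b = 1) (v : V) (h : κ → ℝ) :
    Ex wt (fun ω => h (ω v)) = ∑ b, wt v b * h b := by
  have := Ex_prod_single (wt := wt) (fun u b => if u = v then h b else 1)
  simp only [Finset.prod_ite_eq', Finset.mem_univ, if_true] at this
  rw [this, Finset.prod_eq_single v]
  · simp
  · intro u _ hu
    simp [hu, h1]
  · simp

theorem exists_ge_Ex {wt : V → κ → ℝ} (h0 : ∀ v b, 0 ≤ wt v b) (h1 : ∀ v, ∑ b, wt v b = 1)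
    (f : (V → κ) → ℝ) {a : ℝ} (ha : a ≤ Ex wt f) : ∃ ω, a ≤ f ω := by
  by_contra! hcon
  have hsum : ∑ ω : V → κ, (∏ v, wt v (ω v)) = 1 := by
    have := Ex_const h1 1
    simpa [Ex] using this
  have hle : ∀ ω, (∏ v, wt v (ω v)) * f ω ≤ (∏ v, wt v (ω v)) * a := fun ω =>
    mul_le_mul_of_nonneg_left (hcon ω).le (Finset.prod_nonneg fun v _ => h0 v _)
  have hpos : ∃ ω : V → κ, 0 < ∏ v, wt v (ω v) := by
    by_contra! hn
    have : ∑ ω : V → κ, (∏ v, wt v (ω v)) ≤ 0 := Finset.sum_nonpos fun ω _ => hn ω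
    linarith
  obtain ⟨ω, hω⟩ := hpos
  have : Ex wt f < ∑ ω : V → κ, (∏ v, wt v (ω v)) * a :=
    Finset.sum_lt_sum (fun ω _ => hle ω) ⟨ω, Finset.mem_univ _, mul_lt_mul_of_pos_left (hcon ω) hω⟩
  rw [← Finset.sum_mul, hsum, one_mul] at this
  linarith

theorem Ex_mul [Inhabited κ] {wt : V → κ → ℝ} (h1 : ∀ v, ∑ b, wt v b = 1)
    {f g : (V → κ) → ℝ} {S T : Finset V}
    (hf : DependsOn f S) (hg : DependsOn g T) (hST : Disjoint S T) :
    Ex wt (fun ω => f ω * g ω) = Ex wt f * Ex wt g := by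
  let e := Equiv.piEquivPiSubtypeProd (fun v => v ∈ S) (fun _ : V => κ)
  let a0 : {v // v ∈ S} → κ := fun _ => default
  let b0 : {v // ¬ v ∈ S} → κ := fun _ => default
  let f' : ({v // v ∈ S} → κ) → ℝ := fun a => f (e.symm (a, b0))
  let g' : ({v // ¬ v ∈ S} → κ) → ℝ := fun b => g (e.symm (a0, b))
  have hf' : ∀ a b, f (e.symm (a, b)) = f' a := by
    intro a b
    apply hf
    intro i hi
    have hi' : i ∈ S := hi
    simp [e, Equiv.piEquivPiSubtypeProd, hi']
  have hg' : ∀ a b, g (e.symm (a, b)) = g' b := by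
    intro a b
    apply hg
    intro i hi
    have hi' : i ∉ S := fun h => Finset.disjoint_left.1 hST h hi
    simp [e, Equiv.piEquivPiSubtypeProd, hi']
  have key : ∀ (φ : ({v // v ∈ S} → κ) → ℝ) (ψ : ({v // ¬ v ∈ S} → κ) → ℝ)
      (F : (V → κ) → ℝ) (_ : ∀ a b, F (e.symm (a, b)) = φ a * ψ b),
      Ex wt F = (∑ a : {v // v ∈ S} → κ, (∏ v, wt v.1 (a v)) * φ a) *
        (∑ b : {v // ¬ v ∈ S} → κ, (∏ v, wt v.1 (b v)) * ψ b) := by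
    intro φ ψ F hF
    unfold Ex
    rw [← Equiv.sum_comp e.symm, Fintype.sum_prod_type, Finset.sum_mul_sum]
    refine Finset.sum_congr rfl fun a _ => Finset.sum_congr rfl fun b _ => ?_
    rw [hF, ← Fintype.prod_subtype_mul_prod_subtype (fun v => v ∈ S)]
    have e1 : ∀ v : {v // v ∈ S}, (e.symm (a, b)) v.1 = a v := by
      intro v; simp [e, Equiv.piEquivPiSubtypeProd, v.2]
    have e2 : ∀ v : {v // ¬ v ∈ S}, (e.symm (a, b)) v.1 = b v := by
      intro v; simp [e, Equiv.piEquivPiSubtypeProd, v.2]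
    simp only [e1, e2]
    rw [mul_mul_mul_comm]
    congr!
  have k1 := key f' g' (fun ω => f ω * g ω) (fun a b => by simp only [hf', hg'])
  have k2 := key f' (fun _ => 1) f (fun a b => by simp only [hf', mul_one])
  have k3 := key (fun _ => 1) g' g (fun a b => by simp only [hg', one_mul])
  have k4 := key (fun _ => 1) (fun _ => 1) (fun _ => 1) (fun a b => by simp)
  rw [Ex_const h1] at k4
  rw [k1, k2, k3]
  linear_combination (∑ a : {v // v ∈ S} → κ, (∏ v, wt v.1 (a v)) * f' a) *
        (∑ b : {v // ¬ v ∈ S} → κ, (∏ v, wt v.1 (b v)) * g' b) * k4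

set_option linter.unusedSectionVars false in
theorem dependsOn_prod {ι : Type*} {f : ι → (V → κ) → ℝ} {T : ι → Finset V} (s : Finset ι)
    (h : ∀ i ∈ s, DependsOn (f i) (T i)) :
    DependsOn (fun ω => ∏ i ∈ s, f i ω) (s.biUnion T : Finset V) := by
  intro x y hxy
  refine Finset.prod_congr rfl fun i hi => h i hi fun v hv => hxy v ?_
  simp only [Finset.coe_biUnion, Set.mem_iUnion]
  exact ⟨i, hi, hv⟩

theorem Ex_prod [Inhabited κ] {ι : Type*} {wt : V → κ → ℝ} (h1 : ∀ v, ∑ b, wt v b = 1)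
    {f : ι → (V → κ) → ℝ} {T : ι → Finset V} (s : Finset ι)
    (h : ∀ i ∈ s, DependsOn (f i) (T i))
    (hd : ∀ i ∈ s, ∀ j ∈ s, i ≠ j → Disjoint (T i) (T j)) :
    Ex wt (fun ω => ∏ i ∈ s, f i ω) = ∏ i ∈ s, Ex wt (f i) := by
  classical
  induction s using Finset.induction_on with
  | empty => simp [Ex_const h1]
  | insert a s ha ih =>
    simp only [Finset.prod_insert ha]
    rw [Ex_mul h1 (h a (Finset.mem_insert_self _ _))
      (dependsOn_prod s fun i hi => h i (Finset.mem_insert_of_mem hi)) ?_]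
    · rw [ih (fun i hi => h i (Finset.mem_insert_of_mem hi))
        (fun i hi j hj => hd i (Finset.mem_insert_of_mem hi) j (Finset.mem_insert_of_mem hj))]
    · rw [Finset.disjoint_biUnion_right]
      intro i hi
      exact hd a (Finset.mem_insert_self _ _) i (Finset.mem_insert_of_mem hi)
        (fun h => ha (h ▸ hi))

/-- Chebyshev for sums of pairwise independent indicators. -/
theorem cheb [Inhabited κ] {ι : Type*} {wt : V → κ → ℝ} (h0 : ∀ v b, 0 ≤ wt v b)
    (h1 : ∀ v, ∑ b, wt v b = 1)
    {Y : ι → (V → κ) → ℝ} {T : ι → Finset V} (s : Finset ι)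
    (h : ∀ i ∈ s, DependsOn (Y i) (T i))
    (hd : ∀ i ∈ s, ∀ j ∈ s, i ≠ j → Disjoint (T i) (T j))
    (hY : ∀ i ∈ s, ∀ ω, Y i ω = 0 ∨ Y i ω = 1) {μ ε : ℝ} (hμ : 0 < μ) (hε : 0 < ε)
    (hm : ∑ i ∈ s, Ex wt (Y i) ≤ μ) :
    Ex wt (fun ω => if (1 + ε) * μ < ∑ i ∈ s, Y i ω then 1 else 0) ≤ 1 / (ε ^ 2 * μ) := by
  classical
  set m := ∑ i ∈ s, Ex wt (Y i) with hmdef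
  have hvar : Ex wt (fun ω => (∑ i ∈ s, Y i ω - m) ^ 2) ≤ m := by
    have e1 : Ex wt (fun ω => (∑ i ∈ s, Y i ω - m) ^ 2)
        = ∑ i ∈ s, ∑ j ∈ s, Ex wt (fun ω => Y i ω * Y j ω) - m ^ 2 := by
      have : (fun ω => (∑ i ∈ s, Y i ω - m) ^ 2) = fun ω : V → κ =>
          (∑ i ∈ s, ∑ j ∈ s, Y i ω * Y j ω) - ((2 * m) * (∑ i ∈ s, Y i ω) - m ^ 2) := by
        funext ω
        rw [← Finset.sum_mul_sum]; ring
      rw [this, Ex_sub, Ex_sub, Ex_smul, Ex_sum, Ex_sum, Ex_const h1, ← hmdef]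
      simp only [Ex_sum]
      ring
    have e2 : ∀ i ∈ s, ∑ j ∈ s, Ex wt (fun ω => Y i ω * Y j ω) ≤
        Ex wt (Y i) * m + Ex wt (Y i) := by
      intro i hi
      have e3 : ∀ j ∈ s, Ex wt (fun ω => Y i ω * Y j ω) ≤
          Ex wt (Y i) * Ex wt (Y j) + if i = j then Ex wt (Y i) else 0 := by
        intro j hj
        by_cases hij : i = j
        · subst hij
          have : (fun ω => Y i ω * Y i ω) = Y i := by
            funext ω
            rcases hY i hi ω with h | h <;> simp [h]
          simp only [this, if_true]
          nlinarith [mul_self_nonneg (Ex wt (Y i))]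
        · rw [Ex_mul h1 (h i hi) (h j hj) (hd i hi j hj hij)]
          simp [hij]
      refine (Finset.sum_le_sum e3).trans ?_
      rw [Finset.sum_add_distrib, ← Finset.mul_sum]
      simp [hi, ← hmdef]
    rw [e1]
    have := Finset.sum_le_sum e2
    rw [Finset.sum_add_distrib, ← Finset.sum_mul, ← hmdef] at this
    nlinarith
  have hle : ∀ ω, (if (1 + ε) * μ < ∑ i ∈ s, Y i ω then (1 : ℝ) else 0) ≤
      (1 / (ε * μ) ^ 2) * (∑ i ∈ s, Y i ω - m) ^ 2 := by
    intro ω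
    split_ifs with hc
    · rw [one_div, inv_mul_eq_div, le_div_iff₀ (by positivity), one_mul]
      apply pow_le_pow_left₀ (by positivity)
      nlinarith
    · positivity
  refine (Ex_mono h0 hle).trans ?_
  rw [Ex_smul]
  calc 1 / (ε * μ) ^ 2 * Ex wt (fun ω => (∑ i ∈ s, Y i ω - m) ^ 2)
      ≤ 1 / (ε * μ) ^ 2 * μ := by gcongr; linarith
    _ = 1 / (ε ^ 2 * μ) := by field_simp

end Prob
end DLR


namespace DLR
open Finset

section Defs
variable {V : Type*} [DecidableEq V]

/-- Uncrowded linear uniform hypergraphs. -/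
structure Unc (H : Finset (Finset V)) (r : ℕ) : Prop where
  unif : ∀ E ∈ H, E.card = r
  lin : ∀ E ∈ H, ∀ F ∈ H, E ≠ F → ∀ x y, x ∈ E → x ∈ F → y ∈ E → y ∈ F → x = y
  no3 : ∀ E ∈ H, ∀ F ∈ H, ∀ G ∈ H, E ≠ F → F ≠ G → G ≠ E → ∀ x y z,
    x ∈ E → x ∈ F → y ∈ F → y ∈ G → z ∈ G → z ∈ E → x = y
  no4 : ∀ E ∈ H, ∀ F ∈ H, ∀ G ∈ H, ∀ K ∈ H, (E ∩ F).Nonempty → (F ∩ G).Nonempty →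
    (G ∩ K).Nonempty → (K ∩ E).Nonempty → E ∩ G = ∅ → F ∩ K = ∅ → False

/-- live edges -/
def live (H : Finset (Finset V)) (A I : Finset V) : Finset (Finset V) := H.filter (· ⊆ A ∪ I)

/-- live edges at a vertex -/
def Nb (H : Finset (Finset V)) (A I : Finset V) (u : V) : Finset (Finset V) :=
  (live H A I).filter (u ∈ ·)

/-- the active link of `u` in `E` -/
def lk (A E : Finset V) (u : V) : Finset V := (E ∩ A).erase u

/-- number of live edges of rank `k` at `v` -/
def dg (H : Finset (Finset V)) (A I : Finset V) (k : ℕ) (v : V) : ℕ :=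
  ((Nb H A I v).filter (fun E => (E ∩ A).card = k)).card

/-- valid states -/
def Valid (H : Finset (Finset V)) (A I : Finset V) : Prop :=
  Disjoint A I ∧ ∀ E ∈ live H A I, 2 ≤ (E ∩ A).card

theorem mem_live {H : Finset (Finset V)} {A I E : Finset V} :
    E ∈ live H A I ↔ E ∈ H ∧ E ⊆ A ∪ I := by simp [live]

theorem mem_Nb {H : Finset (Finset V)} {A I E : Finset V} {u : V} :
    E ∈ Nb H A I u ↔ (E ∈ H ∧ E ⊆ A ∪ I) ∧ u ∈ E := by simp [Nb, live]

theorem mem_lk {A E : Finset V} {u x : V} : x ∈ lk A E u ↔ x ≠ u ∧ x ∈ E ∧ x ∈ A := by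
  simp [lk]

theorem card_lk {A E : Finset V} {u : V} (h1 : u ∈ E) (h2 : u ∈ A) :
    (lk A E u).card = (E ∩ A).card - 1 := by
  rw [lk, card_erase_of_mem (by simp [h1, h2])]

/-- coordinates on which survival of `u` (avoiding the edge `E`) depends -/
def Tset (H : Finset (Finset V)) (A I : Finset V) (E : Finset V) (u : V) : Finset V :=
  insert u (((Nb H A I u).erase E).biUnion (fun F => lk A F u))

/-- coordinates relevant for an edge `E` at `v` -/
def Sset (H : Finset (Finset V)) (A I : Finset V) (v : V) (E : Finset V) : Finset V :=
  (lk A E v).biUnion (Tset H A I E)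

variable {H : Finset (Finset V)} {r : ℕ} {A I : Finset V}

theorem disj1 (hU : Unc H r) {u : V} {E F : Finset V} (hE : E ∈ Nb H A I u)
    (hF : F ∈ Nb H A I u) (hEF : E ≠ F) : Disjoint (lk A E u) (lk A F u) := by
  rw [Finset.disjoint_left]
  intro x hx hx'
  rw [mem_lk] at hx hx'
  rw [mem_Nb] at hE hF
  exact hx.1 (hU.lin E hE.1.1 F hF.1.1 hEF x u hx.2.1 hx'.2.1 hE.2 hF.2)

theorem mem_Tset {E : Finset V} {u x : V} : x ∈ Tset H A I E u ↔
    x = u ∨ ∃ F, F ∈ H ∧ u ∈ F ∧ F ≠ E ∧ F ⊆ A ∪ I ∧ x ∈ F ∧ x ≠ u ∧ x ∈ A := by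
  simp only [Tset, mem_insert, mem_biUnion, mem_erase, mem_Nb, mem_lk]
  constructor
  · rintro (h | ⟨F, h1, h2⟩)
    · exact Or.inl h
    · exact Or.inr ⟨F, by tauto⟩
  · rintro (h | ⟨F, h1⟩)
    · exact Or.inl h
    · exact Or.inr ⟨F, by tauto⟩

theorem disj2 (hU : Unc H r) {E : Finset V} (hE : E ∈ H) {u u' : V} (hu : u ∈ E) (hu' : u' ∈ E)
    (hne : u ≠ u') : Disjoint (Tset H A I E u) (Tset H A I E u') := by
  rw [Finset.disjoint_left]
  intro x hx hx'
  rw [mem_Tset] at hx hx'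
  rcases hx with rfl | ⟨F, hF, huF, hFE, -, hxF, hxu, -⟩
  · rcases hx' with rfl | ⟨F', hF', huF', hFE', -, hxF', hxu', -⟩
    · exact hne rfl
    · exact hne (hU.lin E hE F' hF' hFE'.symm x u' hu hxF' hu' huF')
  · rcases hx' with rfl | ⟨F', hF', huF', hFE', -, hxF', hxu', -⟩
    · exact hne (hU.lin E hE F hF hFE.symm u x hu huF hu' hxF)
    · by_cases hFF : F = F'
      · subst hFF
        exact hne (hU.lin E hE F hF hFE.symm u u' hu huF hu' huF')
      · exact hxu (hU.no3 E hE F hF F' hF' hFE.symm hFF hFE' u x u' hu huF hxF hxF' huF' hu').symm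

theorem disj3 (hU : Unc H r) {v : V} {E E' : Finset V} (hE : E ∈ H) (hE' : E' ∈ H)
    (hvE : v ∈ E) (hvE' : v ∈ E') (hEE : E ≠ E') :
    Disjoint (Sset H A I v E) (Sset H A I v E') := by
  rw [Finset.disjoint_left]
  intro x hx hx'
  simp only [Sset, mem_biUnion] at hx hx'
  obtain ⟨u, hu, hx⟩ := hx
  obtain ⟨u', hu', hx'⟩ := hx'
  rw [mem_lk] at hu hu'
  obtain ⟨huv, huE, -⟩ := hu
  obtain ⟨huv', huE', -⟩ := hu'
  have nE : u ∉ E' := fun h => huv (hU.lin E hE E' hE' hEE u v huE h hvE hvE')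
  have nE' : u' ∉ E := fun h => huv' (hU.lin E hE E' hE' hEE u' v h huE' hvE hvE')
  have tri1 : ∀ F ∈ H, F ≠ E' → u' ∈ F → ∀ z ∈ F, z ∉ E := by
    intro F hF hFE' hu'F z hzF hzE
    have hFE : F ≠ E := fun h => nE' (h ▸ hu'F)
    exact huv' (hU.no3 E hE E' hE' F hF hEE hFE'.symm hFE v u' z hvE hvE' huE' hu'F hzF hzE).symm
  have tri2 : ∀ F ∈ H, F ≠ E → u ∈ F → ∀ z ∈ F, z ∉ E' := by
    intro F hF hFE huF z hzF hzE
    have hFE' : F ≠ E' := fun h => nE (h ▸ huF)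
    exact huv (hU.no3 E' hE' E hE F hF hEE.symm hFE.symm hFE' v u z hvE' hvE huE huF hzF hzE).symm
  rw [mem_Tset] at hx hx'
  rcases hx with rfl | ⟨F, hF, huF, hFE, -, hxF, hxu, -⟩
  · rcases hx' with rfl | ⟨F', hF', huF', hFE', -, hxF', hxu', -⟩
    · exact nE huE'
    · exact tri1 F' hF' hFE' huF' x hxF' huE
  · rcases hx' with rfl | ⟨F', hF', huF', hFE', -, hxF', hxu', -⟩
    · exact tri2 F hF hFE huF x hxF huE'
    · refine hU.no4 E hE E' hE' F' hF' F hF ⟨v, by simp [hvE, hvE']⟩ ⟨u', by simp [*]⟩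
        ⟨x, by simp [*]⟩ ⟨u, by simp [*]⟩ ?_ ?_
      · rw [Finset.eq_empty_iff_forall_notMem]
        intro z hz
        rw [mem_inter] at hz
        exact tri1 F' hF' hFE' huF' z hz.2 hz.1
      · rw [Finset.eq_empty_iff_forall_notMem]
        intro z hz
        rw [mem_inter] at hz
        exact tri2 F hF hFE huF z hz.2 hz.1

theorem sum_Nb (hU : Unc H r) (hV : Valid H A I) (v : V) (φ : ℕ → ℝ) :
    ∑ E ∈ Nb H A I v, φ (E ∩ A).card = ∑ k ∈ Icc 2 r, (dg H A I k v : ℝ) * φ k := by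
  rw [← Finset.sum_fiberwise_of_maps_to (s := Nb H A I v) (t := Icc 2 r)
    (g := fun E => (E ∩ A).card)]
  · refine Finset.sum_congr rfl fun k hk => ?_
    rw [Finset.sum_congr rfl (g := fun _ => φ k)]
    · simp [dg]
    · intro E hE
      rw [(mem_filter.1 hE).2]
  · intro E hE
    rw [mem_Nb] at hE
    rw [mem_Icc]
    exact ⟨hV.2 E (mem_live.2 hE.1), by
      rw [← hU.unif E hE.1.1]; exact card_le_card inter_subset_left⟩

theorem one_sub_sum_le {ι : Type*} (s : Finset ι) (f : ι → ℝ) (h0 : ∀ i ∈ s, 0 ≤ f i)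
    (h1 : ∀ i ∈ s, f i ≤ 1) : 1 - ∑ i ∈ s, f i ≤ ∏ i ∈ s, (1 - f i) := by
  classical
  induction s using Finset.induction_on with
  | empty => simp
  | insert a s ha ih =>
    rw [sum_insert ha, prod_insert ha]
    have i1 := ih (fun i hi => h0 i (mem_insert_of_mem hi)) (fun i hi => h1 i (mem_insert_of_mem hi))
    have a0 := h0 a (mem_insert_self _ _)
    have a1 := h1 a (mem_insert_self _ _)
    have s0 : 0 ≤ ∑ i ∈ s, f i := sum_nonneg fun i hi => h0 i (mem_insert_of_mem hi)
    nlinarith [mul_le_mul_of_nonneg_left i1 (sub_nonneg.2 a1), mul_nonneg a0 s0]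

end Defs
end DLR


namespace DLR
open Finset

section Rand
set_option linter.unusedSectionVars false
variable {V : Type*} [DecidableEq V]

/-- indicator -/
noncomputable def ind (b : Bool) : ℝ := if b then 1 else 0

/-- indicator that the link is chosen -/
noncomputable def bl (A E : Finset V) (u : V) (ω : V → Bool × Bool) : ℝ :=
  ∏ w ∈ lk A E u, ind (ω w).1

/-- indicator that no edge of `s` blocks `u` -/
noncomputable def nb (A : Finset V) (s : Finset (Finset V)) (u : V) (ω : V → Bool × Bool) : ℝ :=
  ∏ E ∈ s, (1 - bl A E u ω)

/-- survival indicator -/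
noncomputable def su (H : Finset (Finset V)) (A I : Finset V) (E : Finset V) (u : V)
    (ω : V → Bool × Bool) : ℝ :=
  ind (ω u).2 * nb A ((Nb H A I u).erase E) u ω

/-- indicator that the link of `v` in `E` survives exactly in `W` -/
noncomputable def gg (H : Finset (Finset V)) (A I : Finset V) (E : Finset V) (v : V)
    (W : Finset V) (ω : V → Bool × Bool) : ℝ :=
  ∏ u ∈ lk A E v, (if u ∈ W then su H A I E u ω else ind (ω u).1)

open Classical in
/-- indicator that `E` contributes to rank `k` -/
noncomputable def YY (H : Finset (Finset V)) (A I : Finset V) (v : V) (k : ℕ) (E : Finset V)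
    (ω : V → Bool × Bool) : ℝ :=
  if ∃ W ∈ powersetCard (k - 1) (lk A E v), gg H A I E v W ω = 1 then 1 else 0

/-- weights -/
noncomputable def wt (p : ℝ) (s : V → ℝ) (v : V) (b : Bool × Bool) : ℝ :=
  (if b.1 then p else 1 - p) * (if b.2 then s v else 1 - s v)

theorem ind01 (b : Bool) : ind b = 0 ∨ ind b = 1 := by cases b <;> simp [ind]

theorem prod01 {ι : Type*} (s : Finset ι) (f : ι → ℝ) (h : ∀ i ∈ s, f i = 0 ∨ f i = 1) :
    (∏ i ∈ s, f i) = 0 ∨ (∏ i ∈ s, f i) = 1 := by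
  by_cases h0 : ∃ i ∈ s, f i = 0
  · obtain ⟨i, hi, h0⟩ := h0
    exact Or.inl (prod_eq_zero hi h0)
  · right
    push Not at h0
    exact prod_eq_one fun i hi => (h i hi).resolve_left (h0 i hi)

theorem bl01 (A E : Finset V) (u : V) (ω : V → Bool × Bool) : bl A E u ω = 0 ∨ bl A E u ω = 1 :=
  prod01 _ _ fun _ _ => ind01 _

theorem nb01 (A : Finset V) (s : Finset (Finset V)) (u : V) (ω : V → Bool × Bool) :
    nb A s u ω = 0 ∨ nb A s u ω = 1 :=
  prod01 _ _ fun E _ => by rcases bl01 A E u ω with h | h <;> simp [h]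

theorem su01 (H : Finset (Finset V)) (A I : Finset V) (E : Finset V) (u : V)
    (ω : V → Bool × Bool) : su H A I E u ω = 0 ∨ su H A I E u ω = 1 := by
  unfold su
  rcases ind01 (ω u).2 with h | h <;> simp [h, nb01]

theorem gg01 (H : Finset (Finset V)) (A I : Finset V) (E : Finset V) (v : V)
    (W : Finset V) (ω : V → Bool × Bool) : gg H A I E v W ω = 0 ∨ gg H A I E v W ω = 1 :=
  prod01 _ _ fun u _ => by
    split_ifs
    · exact su01 ..
    · exact ind01 _

theorem YY01 (H : Finset (Finset V)) (A I : Finset V) (v : V) (k : ℕ) (E : Finset V)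
    (ω : V → Bool × Bool) : YY H A I v k E ω = 0 ∨ YY H A I v k E ω = 1 := by
  unfold YY; split_ifs <;> simp

theorem YY_le (H : Finset (Finset V)) (A I : Finset V) (v : V) (k : ℕ) (E : Finset V)
    (ω : V → Bool × Bool) :
    YY H A I v k E ω ≤ ∑ W ∈ powersetCard (k - 1) (lk A E v), gg H A I E v W ω := by
  have hn : ∀ W, 0 ≤ gg H A I E v W ω := fun W => by
    rcases gg01 H A I E v W ω with h | h <;> simp [h]
  unfold YY
  split_ifs with h
  · obtain ⟨W, hW, h1⟩ := h
    rw [← h1]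
    exact single_le_sum (fun W _ => hn W) hW
  · exact sum_nonneg fun W _ => hn W

theorem dep_ind1 (w : V) : DependsOn (fun ω : V → Bool × Bool => ind (ω w).1)
    (({w} : Finset V) : Set V) := by
  intro x y h
  simp only
  rw [h w (by simp)]

theorem dep_bl (A E : Finset V) (u : V) : DependsOn (bl A E u) (lk A E u : Set V) := by
  intro x y h
  unfold bl
  exact prod_congr rfl fun w hw => by rw [h w hw]

theorem dep_nb (A : Finset V) (s : Finset (Finset V)) (u : V) :
    DependsOn (nb A s u) (s.biUnion (fun F => lk A F u) : Finset V) := by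
  intro x y h
  unfold nb
  refine prod_congr rfl fun E hE => ?_
  rw [dep_bl A E u fun i hi => h i ?_]
  simp only [coe_biUnion, Set.mem_iUnion]
  exact ⟨E, hE, hi⟩

theorem dep_su (H : Finset (Finset V)) (A I : Finset V) (E : Finset V) (u : V) :
    DependsOn (su H A I E u) (Tset H A I E u : Set V) := by
  intro x y h
  unfold su
  rw [h u (by simp [Tset]), dep_nb A _ u fun i hi => h i ?_]
  unfold Tset
  rw [coe_insert]
  exact Set.mem_insert_of_mem _ hi

theorem dep_gu (H : Finset (Finset V)) (A I : Finset V) (E : Finset V) (W : Finset V) (u : V) :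
    DependsOn (fun ω => if u ∈ W then su H A I E u ω else ind (ω u).1)
      (Tset H A I E u : Set V) := by
  intro x y h
  simp only
  split_ifs
  · exact dep_su H A I E u h
  · rw [h u (by simp [Tset])]

theorem dep_gg (H : Finset (Finset V)) (A I : Finset V) (E : Finset V) (v : V) (W : Finset V) :
    DependsOn (gg H A I E v W) (Sset H A I v E : Set V) := by
  intro x y h
  unfold gg
  refine prod_congr rfl fun u hu => ?_
  refine dep_gu H A I E W u fun i hi => h i ?_
  simp only [Sset, coe_biUnion, Set.mem_iUnion]
  exact ⟨u, hu, hi⟩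

theorem dep_YY (H : Finset (Finset V)) (A I : Finset V) (v : V) (k : ℕ) (E : Finset V) :
    DependsOn (YY H A I v k E) (Sset H A I v E : Set V) := by
  intro x y h
  have e : ∀ W, gg H A I E v W x = gg H A I E v W y := fun W => dep_gg H A I E v W h
  unfold YY
  simp only [e]
  congr

theorem wt_nonneg {p : ℝ} {s : V → ℝ} (hp0 : 0 ≤ p) (hp1 : p ≤ 1) (hs0 : ∀ v, 0 ≤ s v)
    (hs1 : ∀ v, s v ≤ 1) (v : V) (b : Bool × Bool) : 0 ≤ wt p s v b := by
  unfold wt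
  have := hs0 v
  have := hs1 v
  apply mul_nonneg <;> split_ifs <;> linarith

theorem wt_sum (p : ℝ) (s : V → ℝ) (v : V) : ∑ b, wt p s v b = 1 := by
  simp [Fintype.sum_prod_type, wt]
  ring

variable [Fintype V] {H : Finset (Finset V)} {r : ℕ} {A I : Finset V} {p : ℝ} {s : V → ℝ}

theorem Ex_ind1 (v : V) : Ex (wt p s) (fun ω => ind (ω v).1) = p := by
  rw [Ex_single (wt_sum p s) v (fun b => ind b.1)]
  simp [Fintype.sum_prod_type, wt, ind]
  ring

theorem Ex_nind1 (v : V) : Ex (wt p s) (fun ω => (1 - ind (ω v).1) * ind (ω v).2) =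
    (1 - p) * s v := by
  rw [Ex_single (wt_sum p s) v (fun b => (1 - ind b.1) * ind b.2)]
  simp [Fintype.sum_prod_type, wt, ind]

theorem Ex_ind2 (v : V) : Ex (wt p s) (fun ω => ind (ω v).2) = s v := by
  rw [Ex_single (wt_sum p s) v (fun b => ind b.2)]
  simp [Fintype.sum_prod_type, wt, ind]
  ring

theorem Ex_bl (E : Finset V) (u : V) : Ex (wt p s) (bl A E u) = p ^ (lk A E u).card := by
  unfold bl
  rw [Ex_prod (wt_sum p s) (T := fun w => {w}) _ (fun w _ => dep_ind1 w)]
  · simp [Ex_ind1]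
  · intro i _ j _ hij
    simpa using hij

theorem Ex_nb (hU : Unc H r) (u : V) {S : Finset (Finset V)} (hS : S ⊆ Nb H A I u) :
    Ex (wt p s) (nb A S u) = ∏ E ∈ S, (1 - p ^ (lk A E u).card) := by
  unfold nb
  rw [Ex_prod (wt_sum p s) (T := fun E => lk A E u) _ ?_ ?_]
  · refine prod_congr rfl fun E _ => ?_
    rw [Ex_sub, Ex_const (wt_sum p s), Ex_bl]
  · intro E _ x y h
    simp only
    rw [dep_bl A E u h]
  · intro E hE F hF hEF
    exact disj1 hU (hS hE) (hS hF) hEF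

/-- probability of not being blocked -/
noncomputable def qq (H : Finset (Finset V)) (A I : Finset V) (p : ℝ) (u : V) : ℝ :=
  ∏ E ∈ Nb H A I u, (1 - p ^ (lk A E u).card)

theorem notMem_biUnion_lk (S : Finset (Finset V)) (u : V) :
    u ∉ S.biUnion (fun F => lk A F u) := by
  simp [mem_lk]

theorem Ex_mul_nb (hU : Unc H r) (u : V) {S : Finset (Finset V)} (hS : S ⊆ Nb H A I u)
    (h : Bool × Bool → ℝ) :
    Ex (wt p s) (fun ω => h (ω u) * nb A S u ω) =
      Ex (wt p s) (fun ω => h (ω u)) * ∏ E ∈ S, (1 - p ^ (lk A E u).card) := by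
  rw [Ex_mul (wt_sum p s) (S := {u}) (T := S.biUnion (fun F => lk A F u)) ?_ (dep_nb A S u) ?_,
    Ex_nb hU u hS]
  · intro x y hxy
    simp only
    rw [hxy u (by simp)]
  · rw [disjoint_singleton_left]
    exact notMem_biUnion_lk S u

theorem Ex_su_le (hU : Unc H r) (hV : Valid H A I) (hp0 : 0 ≤ p) (hp1 : p ≤ 1 / 2) {E : Finset V}
    {u : V} (hE : E ∈ Nb H A I u) (huA : u ∈ A) (hs : s u * qq H A I p u = 1 / 2) :
    Ex (wt p s) (su H A I E u) ≤ 1 / (2 * (1 - p)) := by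
  unfold su
  rw [Ex_mul_nb hU u (erase_subset _ _) (fun b => ind b.2), Ex_ind2]
  have hq : qq H A I p u = (1 - p ^ (lk A E u).card) *
      ∏ F ∈ (Nb H A I u).erase E, (1 - p ^ (lk A F u).card) := by
    unfold qq
    exact (mul_prod_erase _ (fun F => 1 - p ^ (lk A F u).card) hE).symm
  have hc : 1 ≤ (lk A E u).card := by
    have h2 := mem_Nb.1 hE
    rw [card_lk h2.2 huA]
    have := hV.2 E (mem_live.2 h2.1)
    omega
  have hpw : p ^ (lk A E u).card ≤ p := by
    calc p ^ (lk A E u).card ≤ p ^ 1 := pow_le_pow_of_le_one hp0 (by linarith) hc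
      _ = p := pow_one p
  rw [hq] at hs
  have h3 : s u * ∏ F ∈ (Nb H A I u).erase E, (1 - p ^ (lk A F u).card) =
      1 / (2 * (1 - p ^ (lk A E u).card)) := by
    have : (1 - p ^ (lk A E u).card) ≠ 0 := by linarith
    field_simp
    linarith
  rw [h3]
  apply one_div_le_one_div_of_le <;> linarith

theorem Ex_su_nonneg (hp0 : 0 ≤ p) (hp1 : p ≤ 1 / 2) (hs0 : ∀ v, 0 ≤ s v)
    (hs1 : ∀ v, s v ≤ 1) {E : Finset V} {u : V} : 0 ≤ Ex (wt p s) (su H A I E u) := by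
  rw [← Ex_const (wt_sum p s) 0]
  refine Ex_mono (wt_nonneg hp0 (by linarith) hs0 hs1) fun ω => ?_
  rcases su01 H A I E u ω with h | h <;> simp [h]

theorem Ex_YY_le (hU : Unc H r) (hV : Valid H A I) (hp0 : 0 ≤ p) (hp1 : p ≤ 1 / 2)
    (hs0 : ∀ v, 0 ≤ s v) (hs1 : ∀ v, s v ≤ 1)
    (hs : ∀ u ∈ A, s u * qq H A I p u = 1 / 2) {E : Finset V} {v : V} (hvA : v ∈ A)
    (hE : E ∈ Nb H A I v) (k : ℕ) (hk : 2 ≤ k) :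
    Ex (wt p s) (YY H A I v k E) ≤ ((E ∩ A).card - 1).choose (k - 1) * p ^ ((E ∩ A).card - k) *
      (1 / (2 * (1 - p))) ^ (k - 1) := by
  have hE' := mem_Nb.1 hE
  refine (Ex_mono (wt_nonneg hp0 (by linarith) hs0 hs1) (YY_le H A I v k E)).trans ?_
  rw [Ex_sum]
  have hb : ∀ W ∈ powersetCard (k - 1) (lk A E v), Ex (wt p s) (gg H A I E v W) ≤
      p ^ ((E ∩ A).card - k) * (1 / (2 * (1 - p))) ^ (k - 1) := by
    intro W hW
    rw [mem_powersetCard] at hW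
    unfold gg
    rw [Ex_prod (wt_sum p s) (T := Tset H A I E) _ (fun u _ => dep_gu H A I E W u)]
    · rw [← prod_sdiff hW.1]
      have e1 : ∏ u ∈ lk A E v \ W, Ex (wt p s)
          (fun ω => if u ∈ W then su H A I E u ω else ind (ω u).1) = p ^ ((E ∩ A).card - k) := by
        rw [prod_congr rfl (g := fun _ => p)]
        · rw [prod_const, card_sdiff_of_subset hW.1, card_lk hE'.2 hvA, hW.2]
          congr 1
          omega
        · intro u hu
          rw [mem_sdiff] at hu
          simp only [hu.2, if_false]
          exact Ex_ind1 u
      have e2 : ∏ u ∈ W, Ex (wt p s)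
          (fun ω => if u ∈ W then su H A I E u ω else ind (ω u).1) ≤
          (1 / (2 * (1 - p))) ^ (k - 1) := by
        rw [← hW.2, ← prod_const]
        refine prod_le_prod ?_ ?_
        · intro u hu
          simp only [hu, if_true]
          exact Ex_su_nonneg hp0 hp1 hs0 hs1
        · intro u hu
          simp only [hu, if_true]
          have hu' := mem_lk.1 (hW.1 hu)
          exact Ex_su_le hU hV hp0 hp1 (mem_Nb.2 ⟨hE'.1, hu'.2.1⟩) hu'.2.2 (hs u hu'.2.2)
      rw [e1]
      gcongr
    · intro u hu u' hu' hne
      exact disj2 hU hE'.1.1 (mem_lk.1 hu).2.1 (mem_lk.1 hu').2.1 hne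
  refine (sum_le_sum hb).trans ?_
  rw [sum_const, card_powersetCard, card_lk hE'.2 hvA, nsmul_eq_mul, mul_assoc]

end Rand
end DLR


namespace DLR
open Finset

section Step
set_option linter.unusedSectionVars false
variable {V : Type*} [DecidableEq V] [Fintype V] {H : Finset (Finset V)} {r : ℕ} {A I : Finset V}

theorem nb_eq_one {S : Finset (Finset V)} {u : V} {ω : V → Bool × Bool} (h : nb A S u ω = 1)
    {E : Finset V} (hE : E ∈ S) : bl A E u ω = 0 := by
  rcases bl01 A E u ω with h0 | h1
  · exact h0
  · exfalso
    have : nb A S u ω = 0 := prod_eq_zero hE (by rw [h1]; ring)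
    rw [this] at h
    exact zero_ne_one h

theorem nb_erase {S : Finset (Finset V)} {u : V} {ω : V → Bool × Bool} (h : nb A S u ω = 1)
    (E : Finset V) : nb A (S.erase E) u ω = 1 :=
  prod_eq_one fun F hF => by rw [nb_eq_one h (mem_of_mem_erase hF)]; ring

theorem ind_eq_one {b : Bool} : ind b = 1 ↔ b = true := by cases b <;> simp [ind]

open Classical in
theorem step (hU : Unc H r) (hV : Valid H A I) {p β ε : ℝ} {D μ : ℕ → ℝ}
    (hp0 : 0 ≤ p) (hp1 : p ≤ 1 / 2) (hβ : 0 ≤ β) (hε : 0 < ε)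
    (hD : ∀ v ∈ A, ∀ k ∈ Icc 2 r, (dg H A I k v : ℝ) ≤ D k)
    (hsum : ∑ k ∈ Icc 2 r, D k * p ^ (k - 1) ≤ 1 / 2)
    (hμ0 : ∀ k ∈ Icc 2 r, 0 < μ k)
    (hμ : ∀ k ∈ Icc 2 r, ∑ j ∈ Icc 2 r, D j * ((j - 1).choose (k - 1) * p ^ (j - k) *
      (1 / (2 * (1 - p))) ^ (k - 1)) ≤ μ k) :
    ∃ A' I' : Finset V, A' ∪ I' ⊆ A ∪ I ∧ Valid H A' I' ∧
      (∀ v ∈ A', ∀ k ∈ Icc 2 r, (dg H A' I' k v : ℝ) ≤ (1 + ε) * μ k) ∧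
      (I.card : ℝ) + (p / 2 + β * ((1 - p) / 2 - ∑ k ∈ Icc 2 r, 1 / (ε ^ 2 * μ k))) * A.card
        ≤ I'.card + β * A'.card := by
  -- the non-blocking probabilities
  have hq : ∀ u ∈ A, 1 / 2 ≤ qq H A I p u := by
    intro u hu
    have h1 : 1 - ∑ E ∈ Nb H A I u, p ^ (lk A E u).card ≤ qq H A I p u :=
      one_sub_sum_le _ _ (fun E _ => by positivity) (fun E _ => pow_le_one₀ hp0 (by linarith))
    have h2 : ∑ E ∈ Nb H A I u, p ^ (lk A E u).card =
        ∑ E ∈ Nb H A I u, (fun k => p ^ (k - 1)) (E ∩ A).card :=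
      sum_congr rfl fun E hE => by rw [card_lk (mem_Nb.1 hE).2 hu]
    rw [h2, sum_Nb hU hV u (fun k => p ^ (k - 1))] at h1
    have h3 : ∑ k ∈ Icc 2 r, (dg H A I k u : ℝ) * p ^ (k - 1) ≤
        ∑ k ∈ Icc 2 r, D k * p ^ (k - 1) :=
      sum_le_sum fun k hk => mul_le_mul_of_nonneg_right (hD u hu k hk) (by positivity)
    linarith
  set s : V → ℝ := fun u => if u ∈ A then 1 / (2 * qq H A I p u) else 0 with hsdef
  have hs0 : ∀ v, 0 ≤ s v := by
    intro v
    simp only [hsdef]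
    split_ifs with h
    · have := hq v h
      positivity
    · exact le_rfl
  have hs1 : ∀ v, s v ≤ 1 := by
    intro v
    simp only [hsdef]
    split_ifs with h
    · have := hq v h
      rw [div_le_one (by linarith)]
      linarith
    · exact zero_le_one
  have hs : ∀ u ∈ A, s u * qq H A I p u = 1 / 2 := by
    intro u hu
    have := hq u hu
    simp only [hsdef, hu, if_true]
    field_simp
  have hw0 := wt_nonneg (p := p) hp0 (by linarith) hs0 hs1
  have hw1 := wt_sum p s
  -- events
  let fI : V → (V → Bool × Bool) → ℝ := fun v ω => ind (ω v).1 * nb A (Nb H A I v) v ω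
  let fA : V → (V → Bool × Bool) → ℝ := fun v ω =>
    ((1 - ind (ω v).1) * ind (ω v).2) * nb A (Nb H A I v) v ω
  let fB : V → ℕ → (V → Bool × Bool) → ℝ := fun v k ω =>
    if (1 + ε) * μ k < ∑ E ∈ Nb H A I v, YY H A I v k E ω then 1 else 0
  have exI : ∀ v ∈ A, p / 2 ≤ Ex (wt p s) (fI v) := by
    intro v hv
    simp only [fI]
    rw [Ex_mul_nb hU v (Subset.refl _) (fun b => ind b.1), Ex_ind1]
    have := hq v hv
    unfold qq at this
    nlinarith
  have exA : ∀ v ∈ A, (1 - p) / 2 ≤ Ex (wt p s) (fA v) := by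
    intro v hv
    simp only [fA]
    rw [Ex_mul_nb hU v (Subset.refl _) (fun b => (1 - ind b.1) * ind b.2), Ex_nind1]
    have := hs v hv
    unfold qq at this
    rw [mul_assoc, this]
    linarith
  have exB : ∀ v ∈ A, ∀ k ∈ Icc 2 r, Ex (wt p s) (fB v k) ≤ 1 / (ε ^ 2 * μ k) := by
    intro v hv k hk
    have hk2 := (mem_Icc.1 hk).1
    refine cheb hw0 hw1 (T := Sset H A I v) _ (fun E _ => dep_YY H A I v k E) ?_
      (fun E _ ω => YY01 H A I v k E ω) (hμ0 k hk) hε ?_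
    · intro E hE F hF hne
      rw [mem_Nb] at hE hF
      exact disj3 hU hE.1.1 hF.1.1 hE.2 hF.2 hne
    · refine (sum_le_sum fun E hE => Ex_YY_le hU hV hp0 hp1 hs0 hs1 hs hv hE k hk2).trans ?_
      have := sum_Nb hU hV v (fun j => ((j - 1).choose (k - 1) : ℝ) * p ^ (j - k) *
        (1 / (2 * (1 - p))) ^ (k - 1))
      rw [this]
      refine le_trans ?_ (hμ k hk)
      refine sum_le_sum fun j hj => mul_le_mul_of_nonneg_right (hD v hv j hj) ?_
      have : 0 < 1 - p := by linarith
      positivity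
  obtain ⟨ω, hω⟩ := exists_ge_Ex hw0 hw1
    (fun ω => ∑ v ∈ A, (fI v ω + β * (fA v ω - ∑ k ∈ Icc 2 r, fB v k ω)))
    (a := (p / 2 + β * ((1 - p) / 2 - ∑ k ∈ Icc 2 r, 1 / (ε ^ 2 * μ k))) * A.card) (by
      rw [Ex_sum, mul_comm, ← nsmul_eq_mul, ← sum_const]
      refine sum_le_sum fun v hv => ?_
      rw [Ex_add, Ex_smul, Ex_sub, Ex_sum]
      have h3 := sum_le_sum fun k hk => exB v hv k hk
      have := exI v hv
      have := exA v hv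
      gcongr)
  -- the new state
  let J : Finset V := A.filter (fun v => fI v ω = 1)
  obtain ⟨PA, hPA⟩ : ∃ PA : V → Prop, ∀ v, PA v ↔ (fA v ω = 1 ∧
    ∀ k ∈ Icc 2 r, ∑ E ∈ Nb H A I v, YY H A I v k E ω ≤ (1 + ε) * μ k) := ⟨_, fun v => Iff.rfl⟩
  let A' : Finset V := A.filter PA
  have hJ : ∀ v ∈ J, v ∈ A ∧ (ω v).1 = true ∧ nb A (Nb H A I v) v ω = 1 := by
    intro v hv
    obtain ⟨h1, h2⟩ := mem_filter.1 hv
    simp only [fI] at h2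
    refine ⟨h1, ?_⟩
    rcases ind01 (ω v).1 with h | h
    · simp [h] at h2
    · rw [h, one_mul] at h2
      exact ⟨ind_eq_one.1 h, h2⟩
  have hA' : ∀ v ∈ A', v ∈ A ∧ (ω v).1 = false ∧ (ω v).2 = true ∧ nb A (Nb H A I v) v ω = 1 := by
    intro v hv
    obtain ⟨h1, h2'⟩ := mem_filter.1 hv
    have h2 := ((hPA v).1 h2').1
    simp only [fA] at h2
    refine ⟨h1, ?_⟩
    rcases hb1 : (ω v).1 with _ | _ <;> rcases hb2 : (ω v).2 with _ | _ <;>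
      simp [hb1, hb2, ind] at h2 ⊢
    exact h2
  have hsub : A' ∪ (I ∪ J) ⊆ A ∪ I := by
    intro x hx
    simp only [mem_union] at hx ⊢
    rcases hx with h | h | h
    · exact Or.inl (hA' x h).1
    · exact Or.inr h
    · exact Or.inl (hJ x h).1
  have hlive : ∀ E ∈ live H A' (I ∪ J), E ∈ live H A I := fun E hE => by
    rw [mem_live] at hE ⊢
    exact ⟨hE.1, hE.2.trans hsub⟩
  have hAI : ∀ x, x ∈ A → x ∉ I := fun x h1 h2 => Finset.disjoint_left.1 hV.1 h1 h2
  -- other vertices of a surviving edge are chosen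
  have hch : ∀ E ∈ live H A' (I ∪ J), ∀ w ∈ E, w ∈ A → w ∉ A' → w ∈ J := by
    intro E hE w hwE hwA hwA'
    have := (mem_live.1 hE).2 hwE
    simp only [mem_union] at this
    rcases this with h | h | h
    · exact absurd h hwA'
    · exact absurd h (hAI w hwA)
    · exact h
  have hvalid : Valid H A' (I ∪ J) := by
    refine ⟨?_, ?_⟩
    · rw [Finset.disjoint_left]
      intro x hx hx'
      rw [mem_union] at hx'
      have h1 := hA' x hx
      rcases hx' with h | h
      · exact hAI x h1.1 h
      · have h2 := hJ x h
        rw [h1.2.1] at h2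
        exact absurd h2.2.1 (by simp)
    · intro E hE
      by_contra hlt
      have hE2 := hV.2 E (hlive E hE)
      have hcl : (E ∩ A').card ≤ 1 := by omega
      have hex : ∃ u ∈ E, u ∈ A ∧ ∀ w ∈ E, w ∈ A' → w = u := by
        by_cases hemp : (E ∩ A').Nonempty
        · obtain ⟨u, hu⟩ := hemp
          rw [mem_inter] at hu
          refine ⟨u, hu.1, (hA' u hu.2).1, fun w hw hw' => ?_⟩
          exact card_le_one.1 hcl w (by simp [hw, hw']) u (by simp [hu])
        · have : (E ∩ A).Nonempty := by rw [← card_pos]; omega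
          obtain ⟨u, hu⟩ := this
          rw [mem_inter] at hu
          exact ⟨u, hu.1, hu.2, fun w hw hw' => absurd ⟨w, by simp [hw, hw']⟩ hemp⟩
      obtain ⟨u, huE, huA, hu⟩ := hex
      have hnb : nb A (Nb H A I u) u ω = 1 := by
        by_cases h : u ∈ A'
        · exact (hA' u h).2.2.2
        · exact (hJ u (hch E hE u huE huA h)).2.2
      have h0 := nb_eq_one hnb (mem_Nb.2 ⟨mem_live.1 (hlive E hE), huE⟩)
      have h1 : bl A E u ω = 1 := by
        refine prod_eq_one fun w hw => ?_
        rw [mem_lk] at hw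
        rw [ind_eq_one]
        exact (hJ w (hch E hE w hw.2.1 hw.2.2 (fun h => hw.1 (hu w hw.2.1 h)))).2.1
      rw [h0] at h1
      exact zero_ne_one h1
  refine ⟨A', I ∪ J, ?_, hvalid, ?_, ?_⟩
  · intro x hx
    simp only [mem_union] at hx ⊢
    rcases hx with hx | hx | hx
    · exact Or.inl (hA' x hx).1
    · exact Or.inr hx
    · exact Or.inl (hJ x hx).1
  · intro v hv k hk
    refine le_trans ?_ (((hPA v).1 (mem_filter.1 hv).2).2 k hk)
    have hvA := hA' v hv
    have h1 : ∀ E ∈ (Nb H A' (I ∪ J) v).filter (fun E => (E ∩ A').card = k),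
        E ∈ Nb H A I v ∧ YY H A I v k E ω = 1 := by
      intro E hE
      obtain ⟨hE1, hEk⟩ := mem_filter.1 hE
      have hE2 := mem_Nb.1 hE1
      have hEl : E ∈ live H A' (I ∪ J) := mem_live.2 hE2.1
      refine ⟨mem_Nb.2 ⟨mem_live.1 (hlive E hEl), hE2.2⟩, ?_⟩
      unfold YY
      rw [if_pos]
      refine ⟨lk A' E v, ?_, ?_⟩
      · rw [mem_powersetCard]
        refine ⟨?_, ?_⟩
        · intro x hx
          rw [mem_lk] at hx ⊢
          exact ⟨hx.1, hx.2.1, (hA' x hx.2.2).1⟩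
        · rw [card_lk hE2.2 hv, hEk]
      · refine prod_eq_one fun u hu => ?_
        rw [mem_lk] at hu
        split_ifs with hW
        · rw [mem_lk] at hW
          have := hA' u hW.2.2
          unfold su
          rw [nb_erase this.2.2.2, this.2.2.1]
          simp [ind]
        · rw [ind_eq_one]
          refine (hJ u (hch E hEl u hu.2.1 hu.2.2 fun h => hW ?_)).2.1
          rw [mem_lk]
          exact ⟨hu.1, hu.2.1, h⟩
    calc (dg H A' (I ∪ J) k v : ℝ)
        = ∑ E ∈ (Nb H A' (I ∪ J) v).filter (fun E => (E ∩ A').card = k), (1 : ℝ) := by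
          simp [dg]
      _ = ∑ E ∈ (Nb H A' (I ∪ J) v).filter (fun E => (E ∩ A').card = k), YY H A I v k E ω :=
          sum_congr rfl fun E hE => (h1 E hE).2.symm
      _ ≤ ∑ E ∈ Nb H A I v, YY H A I v k E ω := by
          refine sum_le_sum_of_subset_of_nonneg (fun E hE => (h1 E hE).1) fun E _ _ => ?_
          rcases YY01 H A I v k E ω with h | h <;> simp [h]
  · have hIJ : Disjoint I J := by
      rw [Finset.disjoint_left]
      exact fun x hx hx' => hAI x (hJ x hx').1 hx
    rw [card_union_of_disjoint hIJ]
    have cJ : ∑ v ∈ A, fI v ω = J.card := by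
      have : ∀ v ∈ A, fI v ω = if fI v ω = 1 then 1 else 0 := by
        intro v _
        split_ifs with h
        · exact h
        · simp only [fI] at h ⊢
          rcases ind01 (ω v).1 with h1 | h1 <;>
            rcases nb01 A (Nb H A I v) v ω with h2 | h2 <;> simp [h1, h2] at h ⊢
      rw [sum_congr rfl this, sum_boole]
    have cA : ∑ v ∈ A, (fA v ω - ∑ k ∈ Icc 2 r, fB v k ω) ≤ A'.card := by
      have : ∀ v ∈ A, fA v ω - ∑ k ∈ Icc 2 r, fB v k ω ≤ if PA v then 1 else 0 := by
        intro v _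
        have hB0 : ∀ k, 0 ≤ fB v k ω := fun k => by
          simp only [fB]; split_ifs <;> simp
        have hBs : 0 ≤ ∑ k ∈ Icc 2 r, fB v k ω := sum_nonneg fun k _ => hB0 k
        have hf01 : fA v ω = 0 ∨ fA v ω = 1 := by
          simp only [fA]
          rcases ind01 (ω v).1 with h1 | h1 <;> rcases ind01 (ω v).2 with h3 | h3 <;>
            rcases nb01 A (Nb H A I v) v ω with h2 | h2 <;> simp [h1, h2, h3]
        split_ifs with h
        · rw [((hPA v).1 h).1]; linarith
        · rcases hf01 with h0 | h1
          · rw [h0]; linarith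
          · have : ∃ k ∈ Icc 2 r, (1 + ε) * μ k < ∑ E ∈ Nb H A I v, YY H A I v k E ω := by
              by_contra! hc
              exact h ((hPA v).2 ⟨h1, hc⟩)
            obtain ⟨k, hk, hlt⟩ := this
            have hb : fB v k ω = 1 := by simp only [fB]; rw [if_pos hlt]
            have := single_le_sum (f := fun k => fB v k ω) (fun k _ => hB0 k) hk
            simp only [hb] at this
            rw [h1]; linarith
      refine (sum_le_sum this).trans ?_
      rw [sum_boole]
    rw [sum_add_distrib, ← mul_sum, cJ] at hω
    push_cast
    nlinarith [mul_le_mul_of_nonneg_left cA hβ]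

end Step
end DLR


namespace DLR
open Finset

theorem sum_shift (R : ℕ) (f : ℕ → ℝ) :
    ∑ k ∈ Icc 2 (R + 1), f k = ∑ b ∈ range (R + 1), f (b + 1) - f 1 := by
  rw [sum_range_succ' (fun b => f (b + 1)) R]
  simp only [zero_add, add_sub_cancel_right]
  have : Icc 2 (R + 1) = (range R).image (fun b => b + 1 + 1) := by
    ext x
    simp only [mem_Icc, mem_image, mem_range]
    constructor
    · intro h
      exact ⟨x - 2, by omega, by omega⟩
    · rintro ⟨a, ha, rfl⟩
      omega
  rw [this, sum_image]
  intro a _ b _ h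
  simpa using h

theorem binom_sum (R a : ℕ) (ha : a ≤ R) (z y : ℝ) :
    ∑ b ∈ range (R + 1), (R.choose b : ℝ) * (b.choose a) * z ^ (b - a) * y ^ (R - b) =
      R.choose a * (z + y) ^ (R - a) := by
  obtain ⟨n, rfl⟩ := Nat.exists_eq_add_of_le ha
  rw [add_assoc, sum_range_add, add_pow, mul_sum]
  rw [sum_eq_zero, zero_add]
  · have hn : a + n - a = n := by omega
    rw [hn]
    refine sum_congr rfl fun t ht => ?_
    have ht' := mem_range.1 ht
    have h1 := Nat.choose_mul (n := a + n) (k := a + t) (s := a) (by omega)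
    have h2 : a + n - a = n := by omega
    have h3 : a + t - a = t := by omega
    rw [h2, h3] at h1
    have h4 : a + n - (a + t) = n - t := by omega
    rw [h3, h4]
    have h5 : ((a + n).choose (a + t) : ℝ) * ((a + t).choose a) = (a + n).choose a * n.choose t := by
      exact_mod_cast h1
    rw [h5]
    ring
  · intro b hb
    rw [Nat.choose_eq_zero_of_lt (mem_range.1 hb)]
    simp

/-- ideal degrees -/
noncomputable def idl (R : ℕ) (T : ℝ) (y : ℕ → ℝ) (i k : ℕ) : ℝ :=
  T ^ R * R.choose (k - 1) * (1 / 2 : ℝ) ^ (i * (k - 1)) * y i ^ (R - (k - 1))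

theorem idl_step (R : ℕ) (T : ℝ) (y : ℕ → ℝ) (i k : ℕ) (hk : k ∈ Icc 2 (R + 1)) :
    ∑ j ∈ Icc 2 (R + 1), idl R T y i j * ((j - 1).choose (k - 1) *
      ((y (i + 1) - y i) * 2 ^ i) ^ (j - k) * (1 / 2) ^ (k - 1)) = idl R T y (i + 1) k := by
  obtain ⟨hk1, hk2⟩ := mem_Icc.1 hk
  obtain ⟨a, rfl⟩ : ∃ a, k = a + 1 := ⟨k - 1, by omega⟩
  rw [sum_shift]
  simp only [Nat.add_sub_cancel, Nat.sub_self, Nat.add_sub_add_right]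
  rw [Nat.choose_eq_zero_of_lt (show 0 < a by omega)]
  simp only [Nat.cast_zero, zero_mul, mul_zero, sub_zero]
  have hb := binom_sum R a (by omega) (y (i + 1) - y i) (y i)
  rw [sub_add_cancel] at hb
  simp only [idl, Nat.add_sub_cancel]
  have : T ^ R * (R.choose a) * (1 / 2 : ℝ) ^ ((i + 1) * a) * y (i + 1) ^ (R - a) =
    T ^ R * (1 / 2 : ℝ) ^ ((i + 1) * a) * (R.choose a * y (i + 1) ^ (R - a)) := by ring
  rw [this, ← hb, mul_sum]
  refine sum_congr rfl fun b hb => ?_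
  by_cases hab : b < a
  · rw [Nat.choose_eq_zero_of_lt hab]; simp
  · obtain ⟨t, rfl⟩ := Nat.exists_eq_add_of_le (not_lt.1 hab)
    have h3 : a + t - a = t := by omega
    rw [h3, mul_pow, ← pow_mul]
    have h2 : (1 / 2 : ℝ) ^ (i * (a + t)) * 2 ^ (i * t) * (1 / 2) ^ a = (1 / 2) ^ ((i + 1) * a) := by
      have e1 : i * (a + t) = i * a + i * t := by ring
      have e2 : (i + 1) * a = i * a + a := by ring
      have e3 : (1 / 2 : ℝ) ^ (i * t) * 2 ^ (i * t) = 1 := by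
        rw [← mul_pow]; norm_num
      rw [e1, e2, pow_add, pow_add]
      linear_combination (1 / 2 : ℝ) ^ (i * a) * (1 / 2) ^ a * e3
    rw [← h2]
    ring

theorem idl_sum (R : ℕ) (T : ℝ) (y : ℕ → ℝ) (i : ℕ) :
    ∑ k ∈ Icc 2 (R + 1), idl R T y i k * ((y (i + 1) - y i) * 2 ^ i) ^ (k - 1) =
      T ^ R * (y (i + 1) ^ R - y i ^ R) := by
  rw [sum_shift]
  simp only [Nat.add_sub_cancel, Nat.sub_self, idl]
  have hb := binom_sum R 0 (by omega) (y (i + 1) - y i) (y i)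
  rw [sub_add_cancel] at hb
  simp only [Nat.choose_zero_right, Nat.cast_one, mul_one, one_mul, Nat.sub_zero] at hb
  rw [mul_sub, ← hb, mul_sum]
  congr 1
  · refine sum_congr rfl fun b _ => ?_
    rw [mul_pow, ← pow_mul]
    have e3 : (1 / 2 : ℝ) ^ (i * b) * 2 ^ (i * b) = 1 := by
      rw [← mul_pow]; norm_num
    linear_combination T ^ R * (R.choose b) * y i ^ (R - b) * (y (i + 1) - y i) ^ b * e3
  · simp

section Iter
set_option linter.unusedSectionVars false
variable {V : Type*} [DecidableEq V] [Fintype V] {H : Finset (Finset V)}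

theorem iter {R m : ℕ} (hU : Unc H (R + 1)) {T ε ζ : ℝ} {y : ℕ → ℝ}
    (hT : 0 < T) (hε : 0 < ε) (hζ : ζ ≤ 1) (hζ0 : 0 ≤ ζ)
    (hy0 : ∀ i, 0 ≤ y i) (hypos : ∀ i, 0 < y (i + 1)) (hym : Monotone y)
    (hyR : ∀ i, T ^ R * (y (i + 1) ^ R - y i ^ R) = 1 / 4)
    (hp : ∀ i < m, (y (i + 1) - y i) * 2 ^ i ≤ 1 / 2)
    (hpe : ∀ i < m, 1 ≤ (1 + ε) * (1 - (y (i + 1) - y i) * 2 ^ i) ^ R)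
    (hL : (1 + ε) ^ (2 * m) ≤ 2)
    (hz : ∀ i < m, (y (i + 1) - y i) * 2 ^ i +
      2 * ∑ k ∈ Icc 2 (R + 1), 1 / (ε ^ 2 * idl R T y (i + 1) k) ≤ ζ) :
    ∀ j ≤ m, ∀ A I : Finset V, Valid H A I →
      (∀ v ∈ A, ∀ k ∈ Icc 2 (R + 1), (dg H A I k v : ℝ) ≤
        (1 + ε) ^ (2 * (m - j)) * idl R T y (m - j) k) →
      ∃ J : Finset V, J ⊆ A ∪ I ∧ (∀ E ∈ H, ¬ E ⊆ J) ∧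
        I.card + (y m - y (m - j)) * 2 ^ (m - j) * (1 / 2 * (1 - ζ) ^ j) * A.card ≤ (J.card : ℝ) := by
  intro j
  induction j with
  | zero =>
    intro _ A I hV _
    refine ⟨I, subset_union_right, ?_, by simp⟩
    intro E hE hEI
    have h2 := hV.2 E (mem_live.2 ⟨hE, hEI.trans subset_union_right⟩)
    have : E ∩ A = ∅ := by
      rw [← disjoint_iff_inter_eq_empty]
      exact (hV.1.mono_right hEI).symm
    rw [this] at h2
    simp at h2
  | succ j ih =>
    intro hj A I hV hD
    obtain ⟨i, hi⟩ : ∃ i, i = m - (j + 1) := ⟨_, rfl⟩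
    have hi1 : m - j = i + 1 := by omega
    rw [hi1] at ih
    rw [← hi] at hD ⊢
    have him : i < m := by omega
    set p := (y (i + 1) - y i) * 2 ^ i with hpdef
    have hp0 : 0 ≤ p := mul_nonneg (sub_nonneg.2 (hym (Nat.le_succ i))) (by positivity)
    have hp1 := hp i him
    have hpe1 := hpe i him
    have hz1 := hz i him
    rw [← hpdef] at hp1 hpe1 hz1
    have hL1 : ∀ a, a ≤ 2 * m → (1 + ε) ^ a ≤ 2 := fun a ha =>
      (pow_le_pow_right₀ (by linarith) ha).trans hL
    have hid : ∀ k ∈ Icc 2 (R + 1), 0 < idl R T y (i + 1) k := by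
      intro k hk
      have hk' := mem_Icc.1 hk
      have h1 : 0 < R.choose (k - 1) := Nat.choose_pos (by omega)
      have h2 := hypos i
      unfold idl
      positivity
    set β := (y m - y (i + 1)) * 2 ^ (i + 1) * (1 / 2 * (1 - ζ) ^ j) with hβdef
    have hym1 : 0 ≤ y m - y (i + 1) := sub_nonneg.2 (hym (by omega))
    have hζ1 : 0 ≤ 1 - ζ := by linarith
    have hβ0 : 0 ≤ β := by positivity
    obtain ⟨A', I', hss, hV', hD', hc⟩ := step hU hV (p := p) (β := β) (ε := ε)
      (D := fun k => (1 + ε) ^ (2 * i) * idl R T y i k)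
      (μ := fun k => (1 + ε) ^ (2 * i + 1) * idl R T y (i + 1) k) hp0 hp1 hβ0 hε hD
      (by
        simp only [mul_assoc]
        rw [← mul_sum, idl_sum, hyR]
        have := hL1 (2 * i) (by omega)
        linarith)
      (fun k hk => mul_pos (by positivity) (hid k hk))
      (by
        intro k hk
        simp only [mul_assoc]
        rw [← mul_sum, pow_succ, mul_assoc]
        refine mul_le_mul_of_nonneg_left ?_ (by positivity)
        rw [← idl_step R T y i k hk, mul_sum]
        refine sum_le_sum fun j hj => ?_
        have hk' := mem_Icc.1 hk
        have hj0 : 0 ≤ idl R T y i j := by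
          have := hy0 i
          unfold idl
          positivity
        have hkey : (1 / (2 * (1 - p))) ^ (k - 1) ≤ (1 + ε) * (1 / 2) ^ (k - 1) := by
          have h1p : 0 < 1 - p := by linarith
          rw [one_div, mul_inv, mul_pow, mul_comm, one_div]
          refine mul_le_mul_of_nonneg_right ?_ (by positivity)
          rw [inv_pow, inv_le_iff_one_le_mul₀ (by positivity)]
          refine hpe1.trans (mul_le_mul_of_nonneg_left ?_ (by positivity))
          exact pow_le_pow_of_le_one h1p.le (by linarith) (by omega)
        rw [← hpdef]
        calc idl R T y i j * (((j - 1).choose (k - 1) : ℝ) * (p ^ (j - k) *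
              (1 / (2 * (1 - p))) ^ (k - 1)))
            ≤ idl R T y i j * (((j - 1).choose (k - 1) : ℝ) * (p ^ (j - k) *
              ((1 + ε) * (1 / 2) ^ (k - 1)))) := by gcongr
          _ = _ := by ring)
    obtain ⟨J, hJs, hJ, hJc⟩ := ih (by omega) A' I' hV' (by
      intro v hv k hk
      refine (hD' v hv k hk).trans (le_of_eq ?_)
      ring)
    refine ⟨J, hJs.trans hss, hJ, le_trans ?_ hJc⟩
    refine le_trans ?_ hc
    refine add_le_add_right (mul_le_mul_of_nonneg_right ?_ (Nat.cast_nonneg _)) _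
    have hη : ∑ k ∈ Icc 2 (R + 1), 1 / (ε ^ 2 * ((1 + ε) ^ (2 * i + 1) * idl R T y (i + 1) k)) ≤
        ∑ k ∈ Icc 2 (R + 1), 1 / (ε ^ 2 * idl R T y (i + 1) k) := by
      refine sum_le_sum fun k hk => ?_
      have h1 := hid k hk
      apply one_div_le_one_div_of_le (by positivity)
      refine mul_le_mul_of_nonneg_left ?_ (by positivity)
      exact le_mul_of_one_le_left h1.le (one_le_pow₀ (by linarith))
    have h5 : (1 - ζ) / 2 ≤ (1 - p) / 2 -
        ∑ k ∈ Icc 2 (R + 1), 1 / (ε ^ 2 * ((1 + ε) ^ (2 * i + 1) * idl R T y (i + 1) k)) := by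
      linarith
    have h6 := mul_le_mul_of_nonneg_left h5 hβ0
    refine le_trans ?_ (add_le_add_right h6 (p / 2))
    have h7 : (1 - ζ) ^ (j + 1) ≤ 1 := pow_le_one₀ hζ1 (by linarith)
    have h8 : β * ((1 - ζ) / 2) = (y m - y (i + 1)) * 2 ^ i * (1 / 2 * (1 - ζ) ^ (j + 1)) := by
      rw [hβdef]; ring
    rw [h8]
    have h9 : p * (1 - ζ) ^ (j + 1) ≤ p := mul_le_of_le_one_right hp0 h7
    have h10 : (y m - y i) * 2 ^ i * (1 / 2 * (1 - ζ) ^ (j + 1)) =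
      (y m - y (i + 1)) * 2 ^ i * (1 / 2 * (1 - ζ) ^ (j + 1)) + p * (1 - ζ) ^ (j + 1) / 2 := by
      rw [hpdef]; ring
    rw [h10]
    linarith

end Iter
end DLR


namespace DLR
open Finset

section Nib
variable {V : Type*} [DecidableEq V] [Fintype V] {H : Finset (Finset V)}

/-- the nibble potential -/
noncomputable def ww (R i : ℕ) : ℝ := ((i : ℝ) / 4) ^ ((R : ℝ)⁻¹)

theorem ww_nonneg (R i : ℕ) : 0 ≤ ww R i := by unfold ww; positivity

theorem ww_pow {R : ℕ} (hR : 2 ≤ R) (i : ℕ) : ww R i ^ R = i / 4 :=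
  Real.rpow_inv_natCast_pow (by positivity) (by omega)

theorem ww_mono (R : ℕ) : Monotone (ww R) := by
  intro i j hij
  unfold ww
  gcongr

theorem ww_lower {R : ℕ} (hR : 2 ≤ R) (i : ℕ) : 1 / 4 ≤ ww R (i + 1) := by
  refine le_of_pow_le_pow_left₀ (n := R) (by omega) (ww_nonneg _ _) ?_
  rw [ww_pow hR]
  have : (1 / 4 : ℝ) ^ R ≤ (1 / 4) ^ 1 := pow_le_pow_of_le_one (by norm_num) (by norm_num) (by omega)
  push_cast
  have h : (0 : ℝ) ≤ i := by positivity
  linarith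

theorem ww_diff {R : ℕ} (hR : 2 ≤ R) (i : ℕ) : ww R (i + 1) - ww R i ≤ 1 := by
  have : ww R (i + 1) ≤ ww R i + 1 := by
    refine le_of_pow_le_pow_left₀ (n := R) (by omega) (by have := ww_nonneg R i; positivity) ?_
    refine le_trans ?_ (pow_add_pow_le (ww_nonneg R i) zero_le_one (by omega))
    rw [ww_pow hR, ww_pow hR]
    push_cast
    rw [one_pow]
    linarith
  linarith

theorem nib_m {R m : ℕ} (hR : 2 ≤ R) (hm : 1 ≤ m) {T : ℝ}
    (hbig : 66 * R * 4 ^ R * (m : ℝ) ^ 3 ≤ Real.exp (R * m)) (hT : Real.exp (R * m) ^ 2 ≤ T)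
    (hU : Unc H (R + 1)) (A : Finset V) (hA : ∀ E ∈ H, E ⊆ A)
    (hdeg : ∀ v ∈ A, ((H.filter (v ∈ ·)).card : ℝ) ≤ T ^ R) :
    ∃ J ⊆ A, (∀ E ∈ H, ¬ E ⊆ J) ∧ ww R m / (4 * T) * A.card ≤ J.card := by
  set Q := Real.exp (R * m) with hQ
  have hR' : (2 : ℝ) ≤ R := by exact_mod_cast hR
  have hm' : (1 : ℝ) ≤ m := by exact_mod_cast hm
  have h4R : (1 : ℝ) ≤ 4 ^ R := one_le_pow₀ (by norm_num)
  have hBQ : ((2 : ℝ) ^ m) ^ R ≤ Q := by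
    have h1 : Q = (Real.exp 1 ^ m) ^ R := by
      rw [← Real.exp_nat_mul, ← Real.exp_nat_mul, hQ, mul_one]
    rw [h1]
    have : (2 : ℝ) ≤ Real.exp 1 := by have := Real.add_one_le_exp (1 : ℝ); linarith
    gcongr
  have hB1 : (1 : ℝ) ≤ 2 ^ m := one_le_pow₀ (by norm_num)
  have hBQ1 : (2 : ℝ) ^ m ≤ Q := (le_self_pow₀ hB1 (by omega)).trans hBQ
  have hQ0 : 0 < Q := Real.exp_pos _
  have hT0 : 0 < T := lt_of_lt_of_le (by positivity) hT
  have hm3 : (m : ℝ) ≤ (m : ℝ) ^ 3 := le_self_pow₀ hm' (by norm_num)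
  have hQm : 8 * R * m ≤ Q := by
    refine le_trans ?_ hbig
    calc (8 : ℝ) * R * m ≤ 66 * R * 1 * (m : ℝ) ^ 3 := by
          rw [mul_one]; gcongr; norm_num
      _ ≤ _ := by gcongr
  have hQ1 : 1 ≤ Q := by nlinarith
  have hQT : Q ≤ T := by nlinarith
  have hT1 : 1 ≤ T := hQ1.trans hQT
  set y : ℕ → ℝ := fun i => ww R i / T with hy
  have hyd : ∀ i, y (i + 1) - y i ≤ 1 / T := by
    intro i
    simp only [hy]
    rw [← sub_div]
    have := ww_diff hR i
    gcongr
  have hym : Monotone y := fun i j hij => by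
    simp only [hy]
    have := ww_mono R hij
    gcongr
  have hp : ∀ i < m, (y (i + 1) - y i) * 2 ^ i ≤ 1 / Q := by
    intro i hi
    calc (y (i + 1) - y i) * 2 ^ i ≤ 1 / T * 2 ^ m := by
          refine mul_le_mul (hyd i) (pow_le_pow_right₀ (by norm_num) hi.le) (by positivity)
            (by positivity)
      _ ≤ 1 / Q ^ 2 * Q := by gcongr
      _ = 1 / Q := by field_simp
  have hp0 : ∀ i, 0 ≤ (y (i + 1) - y i) * 2 ^ i := fun i =>
    mul_nonneg (sub_nonneg.2 (hym (Nat.le_succ i))) (by positivity)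
  have hRQ : (R : ℝ) * (1 / Q) ≤ 1 / (8 * m) := by
    rw [mul_one_div, div_le_div_iff₀ hQ0 (by positivity)]
    nlinarith
  have hidl : ∀ i < m, ∀ k ∈ Icc 2 (R + 1), Q / 4 ^ R ≤ idl R T y (i + 1) k := by
    intro i hi k hk
    have hk' := mem_Icc.1 hk
    obtain ⟨a, rfl⟩ : ∃ a, k = a + 1 := ⟨k - 1, by omega⟩
    obtain ⟨b, hb⟩ : ∃ b, R = a + b := ⟨R - a, by omega⟩
    unfold idl
    have e1 : a + 1 - 1 = a := by omega
    have e2 : R - a = b := by omega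
    rw [e1, e2]
    have c1 : (1 : ℝ) ≤ R.choose a := by
      exact_mod_cast Nat.choose_pos (by omega)
    have c2 : 1 / Q ≤ (1 / 2 : ℝ) ^ ((i + 1) * a) := by
      rw [one_div_pow]
      apply one_div_le_one_div_of_le (by positivity)
      refine le_trans ?_ hBQ
      rw [← pow_mul]
      exact pow_le_pow_right₀ (by norm_num) (Nat.mul_le_mul (by omega) (by omega))
    have c3 : (1 / 4 / T) ^ b ≤ y (i + 1) ^ b := by
      simp only [hy]
      have := ww_lower hR i
      gcongr
    calc Q / 4 ^ R = Q ^ 2 * 1 * (1 / Q) * (1 / 4 ^ R) := by field_simp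
      _ ≤ T ^ a * 1 * (1 / Q) * (1 / 4 ^ b) := by
          have d1 : Q ^ 2 ≤ T ^ a := hT.trans (le_self_pow₀ hT1 (by omega))
          have d2 : (4 : ℝ) ^ b ≤ 4 ^ R := pow_le_pow_right₀ (by norm_num) (by omega)
          gcongr
      _ = T ^ R * 1 * (1 / Q) * (1 / 4 / T) ^ b := by
          rw [hb, pow_add, div_pow, div_pow]; field_simp; simp
      _ ≤ _ := by gcongr
  set ε : ℝ := 1 / (4 * m) with hε
  set ζ : ℝ := 1 / Q + 32 * R * 4 ^ R * (m : ℝ) ^ 2 / Q with hζ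
  have hmζ : m * ζ ≤ 1 / 2 := by
    have : m * ζ = (m + 32 * R * 4 ^ R * (m : ℝ) ^ 3) / Q := by rw [hζ]; field_simp
    rw [this, div_le_iff₀ hQ0]
    have : (m : ℝ) ≤ R * 4 ^ R * (m : ℝ) ^ 3 := by
      calc (m : ℝ) ≤ 1 * 1 * (m : ℝ) ^ 3 := by linarith
        _ ≤ _ := by gcongr; linarith
    nlinarith
  have hζ0 : 0 ≤ ζ := by rw [hζ]; positivity
  have hζ1 : ζ ≤ 1 / 2 := by nlinarith
  have hε0 : 0 < ε := by rw [hε]; positivity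
  have hit := iter (m := m) hU (T := T) (ε := ε) (ζ := ζ) (y := y) hT0 hε0 (by linarith) hζ0
    (fun i => div_nonneg (ww_nonneg _ _) hT0.le)
    (fun i => div_pos (lt_of_lt_of_le (by norm_num) (ww_lower hR i)) hT0) hym
    (fun i => by
      simp only [hy, div_pow, ww_pow hR]
      push_cast
      field_simp
      ring)
    (fun i hi => (hp i hi).trans (by
      rw [div_le_div_iff₀ hQ0 (by norm_num)]; nlinarith))
    (fun i hi => by
      set p := (y (i + 1) - y i) * 2 ^ i with hpd
      have h1 := hp i hi
      have h0 := hp0 i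
      rw [← hpd] at h0 h1
      have hpl : p ≤ 1 := h1.trans (by rw [div_le_one hQ0]; exact hQ1)
      have h2 := one_add_mul_le_pow (a := -p) (by linarith) R
      have h3 : R * p ≤ 1 / (8 * m) := (mul_le_mul_of_nonneg_left h1 (by positivity)).trans hRQ
      have h4 : 1 - 1 / (8 * m) ≤ (1 - p) ^ R := by
        have : (1 + -p) = 1 - p := by ring
        rw [this] at h2
        linarith
      refine le_trans ?_ (mul_le_mul_of_nonneg_left h4 (by positivity))
      rw [hε]
      have h5 : (1 + 1 / (4 * (m : ℝ))) * (1 - 1 / (8 * m)) = 1 + (4 * m - 1) / (32 * (m : ℝ) ^ 2) := by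
        field_simp; ring
      rw [h5]
      have : 0 ≤ (4 * m - 1) / (32 * (m : ℝ) ^ 2) := div_nonneg (by linarith) (by positivity)
      linarith)
    (by
      have h1 : 1 + ε ≤ Real.exp ε := by have := Real.add_one_le_exp ε; linarith
      calc (1 + ε) ^ (2 * m) ≤ Real.exp ε ^ (2 * m) := by gcongr
        _ = Real.exp (1 / 2) := by
            rw [← Real.exp_nat_mul]; congr 1; rw [hε]; push_cast; field_simp; norm_num
        _ ≤ 2 := by
            have h2 : Real.exp (1 / 2) ^ 2 = Real.exp 1 := by
              rw [← Real.exp_nat_mul]; norm_num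
            have h3 := Real.exp_one_lt_d9
            have h4 := Real.exp_pos (1 / 2)
            nlinarith)
    (fun i hi => by
      have h1 : ∑ k ∈ Icc 2 (R + 1), 1 / (ε ^ 2 * idl R T y (i + 1) k) ≤
          ∑ k ∈ Icc 2 (R + 1), 1 / (ε ^ 2 * (Q / 4 ^ R)) := by
        refine sum_le_sum fun k hk => ?_
        have := hidl i hi k hk
        gcongr
      rw [sum_const, nsmul_eq_mul, Nat.card_Icc] at h1
      have h2 : ((R + 1 + 1 - 2 : ℕ) : ℝ) = R := by
        have : R + 1 + 1 - 2 = R := by omega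
        rw [this]
      rw [h2] at h1
      have h3 : (R : ℝ) * (1 / (ε ^ 2 * (Q / 4 ^ R))) = 16 * R * 4 ^ R * (m : ℝ) ^ 2 / Q := by
        rw [hε]; field_simp; norm_num
      rw [h3] at h1
      have h4 : 2 * (16 * R * 4 ^ R * (m : ℝ) ^ 2 / Q) = 32 * R * 4 ^ R * (m : ℝ) ^ 2 / Q := by ring
      have := hp i hi
      rw [hζ]
      linarith)
    m le_rfl A ∅
    (by
      refine ⟨disjoint_empty_right _, fun E hE => ?_⟩
      have hE' := mem_live.1 hE
      rw [inter_eq_left.2 (hA E hE'.1), hU.unif E hE'.1]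
      omega)
    (by
      intro v hv k hk
      rw [Nat.sub_self, mul_zero, pow_zero, one_mul]
      by_cases hkR : k = R + 1
      · subst hkR
        have : idl R T y 0 (R + 1) = T ^ R := by simp [idl]
        rw [this]
        refine le_trans ?_ (hdeg v hv)
        norm_cast
        unfold dg
        refine card_le_card fun E hE => ?_
        have := mem_Nb.1 (mem_filter.1 hE).1
        exact mem_filter.2 ⟨this.1.1, this.2⟩
      · have h0 : dg H A ∅ k v = 0 := by
          unfold dg
          rw [card_eq_zero, filter_eq_empty_iff]
          intro E hE
          have hE' := mem_Nb.1 hE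
          rw [inter_eq_left.2 (hA E hE'.1.1), hU.unif E hE'.1.1]
          omega
        rw [h0]
        have : 0 ≤ y 0 := div_nonneg (ww_nonneg _ _) hT0.le
        unfold idl
        rw [Nat.cast_zero]
        positivity)
  obtain ⟨J, hJA, hJ, hJc⟩ := hit
  refine ⟨J, by simpa using hJA, hJ, le_trans ?_ hJc⟩
  have hy0 : y 0 = 0 := by
    simp only [hy, ww]
    rw [Nat.cast_zero, zero_div, Real.zero_rpow (by positivity), zero_div]
  rw [Nat.sub_self, hy0, card_empty, Nat.cast_zero, zero_add, sub_zero, pow_zero, mul_one]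
  have h1 := one_add_mul_le_pow (a := -ζ) (by linarith) m
  have h2 : 1 / 2 ≤ (1 - ζ) ^ m := by
    have : (1 + -ζ) = 1 - ζ := by ring
    rw [this] at h1
    linarith
  have hy1 : 0 ≤ y m := div_nonneg (ww_nonneg _ _) hT0.le
  calc ww R m / (4 * T) * A.card = y m * (1 / 2 * (1 / 2)) * A.card := by
        simp only [hy]; field_simp; ring
    _ ≤ _ := by gcongr

theorem nib {R : ℕ} (hR : 2 ≤ R) : ∃ c : ℝ, 0 < c ∧ ∃ T0 : ℝ, 1 ≤ T0 ∧ ∀ T, T0 ≤ T →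
    ∀ (n : ℕ) (H : Finset (Finset (Fin n))), Unc H (R + 1) → ∀ A : Finset (Fin n),
    (∀ E ∈ H, E ⊆ A) → (∀ v ∈ A, ((H.filter (v ∈ ·)).card : ℝ) ≤ T ^ R) →
    ∃ J ⊆ A, (∀ E ∈ H, ¬ E ⊆ J) ∧
      c * (Real.log T) ^ ((R : ℝ)⁻¹) / T * A.card ≤ J.card := by
  have hR' : (2 : ℝ) ≤ R := by exact_mod_cast hR
  obtain ⟨m0, hm0⟩ : ∃ m0 : ℕ, ∀ m ≥ m0, 1 ≤ m ∧ 66 * R * 4 ^ R * (m : ℝ) ^ 3 ≤ Real.exp (R * m) := by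
    have h1 := (Real.tendsto_exp_div_pow_atTop 3).comp (tendsto_natCast_atTop_atTop (R := ℝ))
    have h2 := h1.eventually_ge_atTop (66 * R * 4 ^ R)
    obtain ⟨m0, h3⟩ := Filter.eventually_atTop.1 (h2.and (Filter.eventually_ge_atTop 1))
    refine ⟨m0, fun m hm => ?_⟩
    obtain ⟨h4, h5⟩ := h3 m hm
    refine ⟨h5, ?_⟩
    have h5' : (1 : ℝ) ≤ m := by exact_mod_cast h5
    simp only [Function.comp] at h4
    rw [le_div_iff₀ (by positivity)] at h4
    refine h4.trans (Real.exp_le_exp.2 ?_)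
    nlinarith
  refine ⟨(1 / (16 * R)) ^ ((R : ℝ)⁻¹) / 4, by positivity, Real.exp (2 * R * m0),
    Real.one_le_exp (by positivity), ?_⟩
  intro T hT n H hU A hA hdeg
  have hT0 : 0 < T := (Real.exp_pos _).trans_le hT
  have hlog : 2 * R * m0 ≤ Real.log T := (Real.le_log_iff_exp_le hT0).2 hT
  set x := Real.log T / (2 * R) with hx
  have hxm : (m0 : ℝ) ≤ x := by rw [hx, le_div_iff₀ (by positivity)]; linarith
  have hx0 : 0 ≤ x := le_trans (by positivity) hxm
  set m := ⌊x⌋₊ with hm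
  obtain ⟨hm1, hmb⟩ := hm0 m (Nat.le_floor hxm)
  have hmx : (m : ℝ) ≤ x := Nat.floor_le hx0
  have hxm1 : x < m + 1 := Nat.lt_floor_add_one x
  have hm1' : (1 : ℝ) ≤ m := by exact_mod_cast hm1
  have hlx : Real.log T = 2 * R * x := by rw [hx]; field_simp
  obtain ⟨J, hJA, hJ, hJc⟩ := nib_m hR hm1 hmb (T := T) (by
    rw [← Real.exp_nat_mul, ← Real.le_log_iff_exp_le hT0, hlx]
    push_cast
    nlinarith) hU A hA hdeg
  refine ⟨J, hJA, hJ, le_trans ?_ hJc⟩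
  have hlog0 : 0 ≤ Real.log T := by rw [hlx]; positivity
  have h1 : (1 / (16 * R)) ^ ((R : ℝ)⁻¹) * (Real.log T) ^ ((R : ℝ)⁻¹) ≤ ww R m := by
    rw [← Real.mul_rpow (by positivity) hlog0]
    unfold ww
    refine Real.rpow_le_rpow (by positivity) ?_ (by positivity)
    rw [hlx]
    have : 1 / (16 * R) * (2 * R * x) = x / 8 := by field_simp; ring
    rw [this]
    linarith
  have key : ∀ a b k : ℝ, a / 4 * b / T * k = a * b / (4 * T) * k := fun a b k => by
    field_simp
  rw [key]
  exact mul_le_mul_of_nonneg_right (div_le_div_of_nonneg_right h1 (by linarith)) (Nat.cast_nonneg _)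

end Nib
end DLR


namespace DLR
open Finset

section Samp
variable {V : Type*} [DecidableEq V] [Fintype V] {H : Finset (Finset V)}

/-- element form of linearity -/
def Lin (H : Finset (Finset V)) : Prop :=
  ∀ E ∈ H, ∀ F ∈ H, E ≠ F → ∀ x y, x ∈ E → x ∈ F → y ∈ E → y ∈ F → x = y

open Classical in
/-- triangles -/
noncomputable def tri (H : Finset (Finset V)) : Finset (Finset V × Finset V × Finset V) :=
  (H ×ˢ H ×ˢ H).filter fun t => t.1 ≠ t.2.1 ∧ t.2.1 ≠ t.2.2 ∧ t.2.2 ≠ t.1 ∧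
    ∃ x y z, x ∈ t.1 ∧ x ∈ t.2.1 ∧ y ∈ t.2.1 ∧ y ∈ t.2.2 ∧ z ∈ t.2.2 ∧ z ∈ t.1 ∧ x ≠ y

open Classical in
/-- quadrilaterals -/
noncomputable def quad (H : Finset (Finset V)) :
    Finset (Finset V × Finset V × Finset V × Finset V) :=
  (H ×ˢ H ×ˢ H ×ˢ H).filter fun t => (t.1 ∩ t.2.1).Nonempty ∧ (t.2.1 ∩ t.2.2.1).Nonempty ∧
    (t.2.2.1 ∩ t.2.2.2).Nonempty ∧ (t.2.2.2 ∩ t.1).Nonempty ∧ t.1 ∩ t.2.2.1 = ∅ ∧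
    t.2.1 ∩ t.2.2.2 = ∅

theorem card_pair (hL : Lin H) {y z : V} (hyz : y ≠ z) :
    (H.filter (fun G => y ∈ G ∧ z ∈ G)).card ≤ 1 := by
  rw [card_le_one]
  intro E hE F hF
  rw [mem_filter] at hE hF
  by_contra hne
  exact hyz (hL E hE.1 F hF.1 hne y z hE.2.1 hF.2.1 hE.2.2 hF.2.2)

theorem card_tri (hL : Lin H) {r D : ℕ} (hr : ∀ E ∈ H, E.card = r)
    (hD : ∀ v, (H.filter (v ∈ ·)).card ≤ D) :
    (tri H).card ≤ Fintype.card V * (D * (D * (r * (r * 1)))) := by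
  classical
  let S : Finset (Finset V × Finset V × Finset V) :=
    univ.biUnion fun x : V => (H.filter (x ∈ ·)).biUnion fun E => (H.filter (x ∈ ·)).biUnion fun F =>
      F.biUnion fun y => E.biUnion fun z =>
        if y = z then ∅ else (H.filter (fun G => y ∈ G ∧ z ∈ G)).image fun G => (E, F, G)
  have hsub : tri H ⊆ S := by
    rintro ⟨E, F, G⟩ ht
    simp only [tri, mem_filter, mem_product] at ht
    obtain ⟨⟨hE, hF, hG⟩, h1, h2, h3, x, y, z, hx, hx', hy, hy', hz, hz', hxy⟩ := ht
    have hyz : y ≠ z := by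
      rintro rfl
      exact hxy (hL E hE F hF h1 x y hx hx' hz' hy)
    simp only [S, mem_biUnion, mem_filter, mem_univ, true_and]
    refine ⟨x, E, ⟨hE, hx⟩, F, ⟨hF, hx'⟩, y, hy, z, hz', ?_⟩
    rw [if_neg hyz]
    exact mem_image.2 ⟨G, mem_filter.2 ⟨hG, hy', hz⟩, rfl⟩
  refine (card_le_card hsub).trans ?_
  rw [← card_univ]
  refine card_biUnion_le_card_mul _ _ _ fun x _ => ?_
  refine (card_biUnion_le_card_mul _ _ (D * (r * (r * 1))) fun E hE => ?_).trans
    (Nat.mul_le_mul_right _ (hD x))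
  refine (card_biUnion_le_card_mul _ _ (r * (r * 1)) fun F hF => ?_).trans
    (Nat.mul_le_mul_right _ (hD x))
  rw [mem_filter] at hE hF
  refine (card_biUnion_le_card_mul _ _ (r * 1) fun y _ => ?_).trans
    (Nat.mul_le_mul_right _ (hr F hF.1).le)
  refine (card_biUnion_le_card_mul _ _ 1 fun z _ => ?_).trans
    (Nat.mul_le_mul_right _ (hr E hE.1).le)
  split_ifs with h
  · simp
  · exact card_image_le.trans (card_pair hL h)

theorem card_quad (hL : Lin H) {r D : ℕ} (hr : ∀ E ∈ H, E.card = r)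
    (hD : ∀ v, (H.filter (v ∈ ·)).card ≤ D) :
    (quad H).card ≤ Fintype.card V * (D * (D * (r * (D * (r * (r * 1)))))) := by
  classical
  let S : Finset (Finset V × Finset V × Finset V × Finset V) :=
    univ.biUnion fun x : V => (H.filter (x ∈ ·)).biUnion fun E => (H.filter (x ∈ ·)).biUnion fun F =>
      F.biUnion fun y => (H.filter (y ∈ ·)).biUnion fun G => G.biUnion fun z => E.biUnion fun w =>
        if z = w then ∅ else (H.filter (fun K => z ∈ K ∧ w ∈ K)).image fun K => (E, F, G, K)
  have hsub : quad H ⊆ S := by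
    rintro ⟨E, F, G, K⟩ ht
    simp only [quad, mem_filter, mem_product] at ht
    obtain ⟨⟨hE, hF, hG, hK⟩, ⟨x, hx⟩, ⟨y, hy⟩, ⟨z, hz⟩, ⟨w, hw⟩, h5, h6⟩ := ht
    rw [mem_inter] at hx hy hz hw
    have hzw : z ≠ w := by
      rintro rfl
      have : z ∈ E ∩ G := mem_inter.2 ⟨hw.2, hz.1⟩
      rw [h5] at this
      simp at this
    simp only [S, mem_biUnion, mem_filter, mem_univ, true_and]
    refine ⟨x, E, ⟨hE, hx.1⟩, F, ⟨hF, hx.2⟩, y, hy.1, G, ⟨hG, hy.2⟩, z, hz.1, w, hw.2, ?_⟩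
    rw [if_neg hzw]
    exact mem_image.2 ⟨K, mem_filter.2 ⟨hK, hz.2, hw.1⟩, rfl⟩
  refine (card_le_card hsub).trans ?_
  rw [← card_univ]
  refine card_biUnion_le_card_mul _ _ _ fun x _ => ?_
  refine (card_biUnion_le_card_mul _ _ (D * (r * (D * (r * (r * 1))))) fun E hE => ?_).trans
    (Nat.mul_le_mul_right _ (hD x))
  refine (card_biUnion_le_card_mul _ _ (r * (D * (r * (r * 1)))) fun F hF => ?_).trans
    (Nat.mul_le_mul_right _ (hD x))
  rw [mem_filter] at hE hF
  refine (card_biUnion_le_card_mul _ _ (D * (r * (r * 1))) fun y _ => ?_).trans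
    (Nat.mul_le_mul_right _ (hr F hF.1).le)
  refine (card_biUnion_le_card_mul _ _ (r * (r * 1)) fun G hG => ?_).trans
    (Nat.mul_le_mul_right _ (hD y))
  rw [mem_filter] at hG
  refine (card_biUnion_le_card_mul _ _ (r * 1) fun z _ => ?_).trans
    (Nat.mul_le_mul_right _ (hr G hG.1).le)
  refine (card_biUnion_le_card_mul _ _ 1 fun w _ => ?_).trans
    (Nat.mul_le_mul_right _ (hr E hE.1).le)
  split_ifs with h
  · simp
  · exact card_image_le.trans (card_pair hL h)

theorem inter_le_one (hL : Lin H) {E F : Finset V} (hE : E ∈ H) (hF : F ∈ H) (h : E ≠ F) :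
    (E ∩ F).card ≤ 1 := by
  rw [card_le_one]
  intro x hx y hy
  rw [mem_inter] at hx hy
  exact hL E hE F hF h x y hx.1 hx.2 hy.1 hy.2

theorem card_union_tri (hL : Lin H) {R : ℕ} (hr : ∀ E ∈ H, E.card = R + 1)
    {t : Finset V × Finset V × Finset V} (ht : t ∈ tri H) :
    3 * R ≤ (t.1 ∪ t.2.1 ∪ t.2.2).card := by
  obtain ⟨E, F, G⟩ := t
  simp only [tri, mem_filter, mem_product] at ht
  obtain ⟨⟨hE, hF, hG⟩, h1, h2, h3, -⟩ := ht
  have a1 := card_union_add_card_inter E F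
  have a2 := card_union_add_card_inter (E ∪ F) G
  have a3 : ((E ∪ F) ∩ G).card ≤ 2 := by
    rw [union_inter_distrib_right]
    have b1 := inter_le_one hL hE hG h3.symm
    have b2 := inter_le_one hL hF hG h2
    have := card_union_le (E ∩ G) (F ∩ G)
    omega
  have a4 := inter_le_one hL hE hF h1
  have := hr E hE
  have := hr F hF
  have := hr G hG
  simp only
  omega

theorem card_union_quad (hL : Lin H) {R : ℕ} (hr : ∀ E ∈ H, E.card = R + 1)
    {t : Finset V × Finset V × Finset V × Finset V} (ht : t ∈ quad H) :
    4 * R ≤ (t.1 ∪ t.2.2.1 ∪ (t.2.1 ∪ t.2.2.2)).card := by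
  obtain ⟨E, F, G, K⟩ := t
  simp only [quad, mem_filter, mem_product] at ht
  obtain ⟨⟨hE, hF, hG, hK⟩, h1, h2, h3, h4, h5, h6⟩ := ht
  have n1 : E ≠ F := by rintro rfl; rw [inter_comm, h6] at h4; simp at h4
  have n2 : F ≠ G := by rintro rfl; rw [h5] at h1; simp at h1
  have n3 : G ≠ K := by rintro rfl; rw [inter_comm, h5] at h4; simp at h4
  have n4 : K ≠ E := by rintro rfl; rw [inter_comm, h6] at h1; simp at h1
  have a1 := card_union_add_card_inter E G
  have a2 := card_union_add_card_inter F K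
  have a3 := card_union_add_card_inter (E ∪ G) (F ∪ K)
  have a4 : ((E ∪ G) ∩ (F ∪ K)).card ≤ 4 := by
    rw [union_inter_distrib_right, inter_union_distrib_left, inter_union_distrib_left]
    have b1 := inter_le_one hL hE hF n1
    have b2 := inter_le_one hL hE hK n4.symm
    have b3 := inter_le_one hL hG hF n2.symm
    have b4 := inter_le_one hL hG hK n3
    have := card_union_le (E ∩ F) (E ∩ K)
    have := card_union_le (G ∩ F) (G ∩ K)
    have := card_union_le (E ∩ F ∪ E ∩ K) (G ∩ F ∪ G ∩ K)
    omega
  rw [h5, card_empty] at a1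
  rw [h6, card_empty] at a2
  have := hr E hE
  have := hr F hF
  have := hr G hG
  have := hr K hK
  simp only
  omega

/-- Bernoulli weights -/
noncomputable def bw (q : ℝ) (_ : V) (b : Bool) : ℝ := if b then q else 1 - q

/-- indicator that the whole of `U` is sampled -/
noncomputable def allin (U : Finset V) (ω : V → Bool) : ℝ := ∏ v ∈ U, ind (ω v)

theorem allin_eq (U : Finset V) (ω : V → Bool) :
    allin U ω = if U ⊆ univ.filter (fun v => ω v = true) then 1 else 0 := by
  unfold allin
  split_ifs with h
  · refine prod_eq_one fun v hv => ?_
    have := (mem_filter.1 (h hv)).2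
    simp [ind, this]
  · rw [not_subset] at h
    obtain ⟨v, hv, hv'⟩ := h
    refine prod_eq_zero hv ?_
    simp at hv'
    simp [ind, hv']

theorem Ex_allin (q : ℝ) (U : Finset V) : Ex (bw q) (allin U) = q ^ U.card := by
  have h := Ex_prod_single (wt := bw (V := V) q) (fun v b => if v ∈ U then ind b else 1)
  have e1 : (fun ω : V → Bool => ∏ v, if v ∈ U then ind (ω v) else 1) = allin U := by
    funext ω
    simp [allin, prod_ite_mem]
  rw [e1] at h
  rw [h]
  have e2 : ∀ v, ∑ b, bw q v b * (if v ∈ U then ind b else 1) = if v ∈ U then q else 1 := by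
    intro v
    split_ifs <;> simp [bw, ind]
  simp only [e2]
  rw [prod_ite_mem]
  simp

theorem Ex_count_le {ι : Type*} {q : ℝ} (hq0 : 0 ≤ q) (hq1 : q ≤ 1) (s : Finset ι)
    (U : ι → Finset V) {a N : ℕ} (hU : ∀ i ∈ s, a ≤ (U i).card) (hs : s.card ≤ N) :
    Ex (bw q) (fun ω => ∑ i ∈ s, allin (U i) ω) ≤ N * q ^ a := by
  rw [Ex_sum]
  calc ∑ i ∈ s, Ex (bw q) (allin (U i)) ≤ ∑ i ∈ s, q ^ a := by
        refine sum_le_sum fun i hi => ?_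
        rw [Ex_allin]
        exact pow_le_pow_of_le_one hq0 hq1 (hU i hi)
    _ = s.card * q ^ a := by simp
    _ ≤ _ := by gcongr

theorem samp (hL : Lin H) {R : ℕ} (hr : ∀ E ∈ H, E.card = R + 1) {D0 : ℕ}
    (hD0 : ∀ v, (H.filter (v ∈ ·)).card ≤ D0) {A1 : Finset V} (hA1 : ∀ E ∈ H, E ⊆ A1)
    {q D : ℝ} (hq0 : 0 ≤ q) (hq1 : q ≤ 1) (hD : 0 < D) :
    ∃ A ⊆ A1, Unc (H.filter (· ⊆ A)) (R + 1) ∧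
      (∀ v ∈ A, (((H.filter (· ⊆ A)).filter (v ∈ ·)).card : ℝ) ≤ D) ∧
      q * A1.card - ((R + 1 : ℕ) / D * (H.card * q ^ (R + 1)) +
        ((Fintype.card V * (D0 * (D0 * ((R + 1) * ((R + 1) * 1)))) : ℕ) * q ^ (3 * R) +
        (Fintype.card V * (D0 * (D0 * ((R + 1) * (D0 * ((R + 1) * ((R + 1) * 1)))))) : ℕ) *
          q ^ (4 * R))) ≤ A.card := by
  classical
  set f : (V → Bool) → ℝ := fun ω => (∑ v ∈ A1, allin {v} ω) -
    ((R + 1 : ℕ) / D * (∑ E ∈ H, allin E ω) + ((∑ t ∈ tri H, allin (t.1 ∪ t.2.1 ∪ t.2.2) ω) +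
      ∑ t ∈ quad H, allin (t.1 ∪ t.2.2.1 ∪ (t.2.1 ∪ t.2.2.2)) ω)) with hf
  have h0 : ∀ (v : V) (b : Bool), 0 ≤ bw q v b := by
    intro v b; unfold bw; split_ifs <;> linarith
  have h1 : ∀ v : V, ∑ b, bw q v b = 1 := by intro v; simp [bw]
  obtain ⟨ω, hω⟩ := exists_ge_Ex h0 h1 f (a := q * A1.card - ((R + 1 : ℕ) / D * (H.card * q ^ (R + 1)) +
        ((Fintype.card V * (D0 * (D0 * ((R + 1) * ((R + 1) * 1)))) : ℕ) * q ^ (3 * R) +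
        (Fintype.card V * (D0 * (D0 * ((R + 1) * (D0 * ((R + 1) * ((R + 1) * 1)))))) : ℕ) *
          q ^ (4 * R)))) (by
    rw [hf, Ex_sub, Ex_add, Ex_add, Ex_smul]
    have e1 : Ex (bw q) (fun ω => ∑ v ∈ A1, allin {v} ω) = q * A1.card := by
      rw [Ex_sum]
      simp [Ex_allin, mul_comm]
    have e2 := Ex_count_le hq0 hq1 H (fun E => E) (fun E hE => (hr E hE).ge) le_rfl
    have e3 := Ex_count_le hq0 hq1 (tri H) (fun t => t.1 ∪ t.2.1 ∪ t.2.2)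
      (fun t ht => card_union_tri hL hr ht) (card_tri hL hr hD0)
    have e4 := Ex_count_le hq0 hq1 (quad H) (fun t => t.1 ∪ t.2.2.1 ∪ (t.2.1 ∪ t.2.2.2))
      (fun t ht => card_union_quad hL hr ht) (card_quad hL hr hD0)
    rw [e1]
    refine sub_le_sub_left (add_le_add (mul_le_mul_of_nonneg_left e2 (by positivity))
      (add_le_add e3 e4)) _)
  set W := univ.filter (fun v => ω v = true) with hW
  set Z := A1.filter (fun v => ω v = true) with hZ
  have hWZ : ∀ U : Finset V, U ⊆ A1 → (U ⊆ W ↔ U ⊆ Z) := by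
    intro U hU
    simp only [hW, hZ, subset_iff, mem_filter, mem_univ, true_and]
    exact ⟨fun h x hx => ⟨hU hx, h hx⟩, fun h x hx => (h hx).2⟩
  -- choice of a vertex in each edge
  have hch : ∀ E : Finset V, ∃ S : Finset V, S.card ≤ 1 ∧ (E ∈ H → ∃ x ∈ S, x ∈ E) := by
    intro E
    by_cases hE : E ∈ H
    · have : E.Nonempty := by rw [← card_pos, hr E hE]; omega
      obtain ⟨x, hx⟩ := this
      exact ⟨{x}, by simp, fun _ => ⟨x, by simp, hx⟩⟩
    · exact ⟨∅, by simp, fun h => absurd h hE⟩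
  choose S hS1 hS2 using hch
  set B3 := ((tri H).filter (fun t => t.1 ∪ t.2.1 ∪ t.2.2 ⊆ W)).biUnion fun t => S t.1 with hB3
  set B4 := ((quad H).filter (fun t => t.1 ∪ t.2.2.1 ∪ (t.2.1 ∪ t.2.2.2) ⊆ W)).biUnion
    fun t => S t.1 with hB4
  set B2 := Z.filter (fun v => D < ((H.filter (· ⊆ W)).filter (v ∈ ·)).card) with hB2
  have c3 : (B3.card : ℝ) ≤ ∑ t ∈ tri H, allin (t.1 ∪ t.2.1 ∪ t.2.2) ω := by
    simp only [allin_eq]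
    rw [sum_boole]
    have := card_biUnion_le_card_mul ((tri H).filter (fun t => t.1 ∪ t.2.1 ∪ t.2.2 ⊆ W))
      (fun t => S t.1) 1 (fun t _ => hS1 _)
    rw [mul_one] at this
    exact_mod_cast this
  have c4 : (B4.card : ℝ) ≤ ∑ t ∈ quad H, allin (t.1 ∪ t.2.2.1 ∪ (t.2.1 ∪ t.2.2.2)) ω := by
    simp only [allin_eq]
    rw [sum_boole]
    have := card_biUnion_le_card_mul
      ((quad H).filter (fun t => t.1 ∪ t.2.2.1 ∪ (t.2.1 ∪ t.2.2.2) ⊆ W))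
      (fun t => S t.1) 1 (fun t _ => hS1 _)
    rw [mul_one] at this
    exact_mod_cast this
  have c2 : (B2.card : ℝ) ≤ (R + 1 : ℕ) / D * (∑ E ∈ H, allin E ω) := by
    simp only [allin_eq]
    rw [sum_boole]
    have k1 : ∑ v : V, ((H.filter (· ⊆ W)).filter (v ∈ ·)).card =
        ∑ E ∈ H.filter (· ⊆ W), E.card := by
      simp only [card_filter _ (H.filter (· ⊆ W))]
      rw [sum_comm]
      refine sum_congr rfl fun E _ => ?_
      rw [← card_filter]
      simp
    have k2 : ∑ E ∈ H.filter (· ⊆ W), E.card = (H.filter (· ⊆ W)).card * (R + 1) := by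
      rw [sum_const_nat]
      intro E hE
      exact hr E (mem_filter.1 hE).1
    rw [k2] at k1
    have k3 : (B2.card : ℝ) * D ≤ ∑ v : V, (((H.filter (· ⊆ W)).filter (v ∈ ·)).card : ℝ) := by
      calc (B2.card : ℝ) * D = ∑ v ∈ B2, D := by simp
        _ ≤ ∑ v ∈ B2, (((H.filter (· ⊆ W)).filter (v ∈ ·)).card : ℝ) :=
            sum_le_sum fun v hv => (mem_filter.1 hv).2.le
        _ ≤ _ := sum_le_sum_of_subset_of_nonneg (subset_univ _) fun _ _ _ => Nat.cast_nonneg _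
    have k4 : ∑ v : V, (((H.filter (· ⊆ W)).filter (v ∈ ·)).card : ℝ) =
        (H.filter (· ⊆ W)).card * ((R + 1 : ℕ) : ℝ) := by exact_mod_cast k1
    rw [k4] at k3
    rw [div_mul_eq_mul_div, le_div_iff₀ hD]
    linarith
  have cZ : ∑ v ∈ A1, allin {v} ω = Z.card := by
    simp only [allin_eq]
    rw [sum_boole]
    simp [hZ]
  set A := Z \ (B2 ∪ (B3 ∪ B4)) with hA
  have hAZ : A ⊆ Z := sdiff_subset
  have hZW : Z ⊆ W := (hWZ Z (filter_subset _ _)).2 subset_rfl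
  refine ⟨A, hAZ.trans (filter_subset _ _), ?_, ?_, ?_⟩
  · refine ⟨fun E hE => hr E (mem_filter.1 hE).1, fun E hE F hF =>
      hL E (mem_filter.1 hE).1 F (mem_filter.1 hF).1, ?_, ?_⟩
    · intro E hE F hF G hG h1 h2 h3 x y z hx hx' hy hy' hz hz'
      by_contra hxy
      rw [mem_filter] at hE hF hG
      obtain ⟨u, hu, hu'⟩ := hS2 E hE.1
      have hb : u ∈ B3 := by
        rw [hB3, mem_biUnion]
        refine ⟨(E, F, G), mem_filter.2 ⟨?_, ?_⟩, hu⟩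
        · simp only [tri, mem_filter, mem_product]
          exact ⟨⟨hE.1, hF.1, hG.1⟩, h1, h2, h3, x, y, z, hx, hx', hy, hy', hz, hz', hxy⟩
        · exact (union_subset (union_subset hE.2 hF.2) hG.2).trans (hAZ.trans hZW)
      have := (mem_sdiff.1 (hE.2 hu')).2
      simp [hb] at this
    · intro E hE F hF G hG K hK h1 h2 h3 h4 h5 h6
      rw [mem_filter] at hE hF hG hK
      obtain ⟨u, hu, hu'⟩ := hS2 E hE.1
      have hb : u ∈ B4 := by
        rw [hB4, mem_biUnion]
        refine ⟨(E, F, G, K), mem_filter.2 ⟨?_, ?_⟩, hu⟩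
        · simp only [quad, mem_filter, mem_product]
          exact ⟨⟨hE.1, hF.1, hG.1, hK.1⟩, h1, h2, h3, h4, h5, h6⟩
        · exact (union_subset (union_subset hE.2 hG.2) (union_subset hF.2 hK.2)).trans
            (hAZ.trans hZW)
      have := (mem_sdiff.1 (hE.2 hu')).2
      simp [hb] at this
  · intro v hv
    have hv' := mem_sdiff.1 hv
    have hn : v ∉ B2 := fun h => hv'.2 (by simp [h])
    have : ¬ D < ((H.filter (· ⊆ W)).filter (v ∈ ·)).card := fun h =>
      hn (mem_filter.2 ⟨hv'.1, h⟩)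
    refine le_trans ?_ (not_lt.1 this)
    norm_cast
    refine card_le_card fun E hE => ?_
    simp only [mem_filter] at hE ⊢
    exact ⟨⟨hE.1.1, hE.1.2.trans (hAZ.trans hZW)⟩, hE.2⟩
  · refine hω.trans ?_
    simp only [hf]
    rw [cZ]
    have k1 := le_card_sdiff (B2 ∪ (B3 ∪ B4)) Z
    have k2 := card_union_le B2 (B3 ∪ B4)
    have k3 := card_union_le B3 B4
    have k4 : Z.card ≤ A.card + (B2.card + (B3.card + B4.card)) := by
      rw [← hA] at k1; omega
    have k5 : (Z.card : ℝ) ≤ A.card + (B2.card + (B3.card + B4.card)) := by exact_mod_cast k4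
    linarith

end Samp
end DLR


namespace DLR
open Finset

theorem main_b {R : ℕ} (hR : 2 ≤ R) : ∃ c : ℝ, 0 < c ∧ ∃ b0 : ℝ, 2 ≤ b0 ∧ ∀ b, b0 ≤ b →
    ∀ (n : ℕ) (H : Finset (Finset (Fin n))), (∀ E ∈ H, E.card = R + 1) → Lin H →
    ((R + 1 : ℕ) : ℝ) * H.card ≤ b ^ (10 * R) * n →
    ∃ I : Finset (Fin n), (∀ E ∈ H, ¬ E ⊆ I) ∧
      c * n * ((Real.log b) ^ ((R : ℝ)⁻¹) / b ^ 10) ≤ I.card := by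
  obtain ⟨c, hc, T0, hT0, hnib⟩ := nib hR
  set r : ℝ := ((R + 1 : ℕ) : ℝ) with hrdef
  have hr1 : 1 ≤ r := by rw [hrdef]; push_cast; have : (0 : ℝ) ≤ R := by positivity
                         linarith
  refine ⟨c / 32, by positivity, max T0 (128 * r), ?_, ?_⟩
  · exact le_trans (by linarith) (le_max_right _ _)
  intro b hb n H hr hL hcard
  have hbT : T0 ≤ b := (le_max_left _ _).trans hb
  have hbr : 128 * r ≤ b := (le_max_right _ _).trans hb
  have hb1 : 1 ≤ b := by linarith
  have hb0 : 0 < b := by linarith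
  set d := b ^ (10 * R) with hd
  have hd0 : 0 < d := by positivity
  set A1 : Finset (Fin n) := univ.filter (fun v => ((H.filter (v ∈ ·)).card : ℝ) ≤ 2 * d) with hA1
  have hA1c : (n : ℝ) / 2 ≤ A1.card := by
    have k1 : ∑ v : Fin n, (H.filter (v ∈ ·)).card = ∑ E ∈ H, E.card := by
      simp only [card_filter _ H]
      rw [sum_comm]
      refine sum_congr rfl fun E _ => ?_
      rw [← card_filter]
      simp
    have k2 : ∑ E ∈ H, E.card = H.card * (R + 1) := by
      rw [sum_const_nat]
      intro E hE
      exact hr E hE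
    rw [k2] at k1
    have k4 : ∑ v : Fin n, ((H.filter (v ∈ ·)).card : ℝ) = H.card * r := by
      rw [hrdef]; exact_mod_cast k1
    set C := univ.filter (fun v => ¬ ((H.filter (v ∈ ·)).card : ℝ) ≤ 2 * d) with hC
    have k3 : (C.card : ℝ) * (2 * d) ≤ ∑ v : Fin n, ((H.filter (v ∈ ·)).card : ℝ) := by
      calc (C.card : ℝ) * (2 * d) = ∑ v ∈ C, (2 * d) := by simp
        _ ≤ ∑ v ∈ C, ((H.filter (v ∈ ·)).card : ℝ) :=
            sum_le_sum fun v hv => (not_le.1 (mem_filter.1 hv).2).le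
        _ ≤ _ := sum_le_sum_of_subset_of_nonneg (subset_univ _) fun _ _ _ => Nat.cast_nonneg _
    have k5 : A1.card + C.card = n := by
      rw [hA1, hC, card_filter_add_card_filter_not]; simp
    have k6 : (A1.card : ℝ) + C.card = n := by exact_mod_cast k5
    have k7 : (C.card : ℝ) * (2 * d) ≤ d * n := by linarith
    have k8 : 2 * (C.card : ℝ) ≤ n := by
      by_contra! h
      nlinarith
    linarith
  set H1 := H.filter (· ⊆ A1) with hH1
  have hH1H : H1 ⊆ H := filter_subset _ _
  set D0 := ⌊2 * d⌋₊ with hD0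
  have hdeg : ∀ v, (H1.filter (v ∈ ·)).card ≤ D0 := by
    intro v
    by_cases hv : v ∈ A1
    · refine Nat.le_floor (le_trans ?_ (mem_filter.1 hv).2)
      norm_cast
      exact card_le_card (filter_subset_filter _ hH1H)
    · have : H1.filter (v ∈ ·) = ∅ := by
        rw [filter_eq_empty_iff]
        intro E hE hvE
        exact hv ((mem_filter.1 hE).2 hvE)
      rw [this]; simp
  have hD0r : (D0 : ℝ) ≤ 2 * d := Nat.floor_le (by positivity)
  set q : ℝ := 1 / b ^ 9 with hq
  have hq0 : 0 < q := by positivity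
  have hq1 : q ≤ 1 := by
    rw [hq, div_le_one (by positivity)]; exact one_le_pow₀ hb1
  have hdq : d * q ^ R = b ^ R := by
    rw [hd, hq, div_pow, one_pow, ← pow_mul]
    rw [mul_one_div, div_eq_iff (by positivity), ← pow_add]
    congr 1; ring
  set D := 8 * b ^ R with hD
  obtain ⟨A, hAA1, hAU, hAd, hAc⟩ := samp (H := H1) (R := R) (D0 := D0) (A1 := A1) (q := q) (D := D)
    (fun E hE F hF => hL E (hH1H hE) F (hH1H hF)) (fun E hE => hr E (hH1H hE)) hdeg
    (fun E hE => (mem_filter.1 hE).2) hq0.le hq1 (by positivity)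
  rw [Fintype.card_fin] at hAc
  have t1 : ((R + 1 : ℕ) : ℝ) / D * (H1.card * q ^ (R + 1)) ≤ n * q / 8 := by
    have hHc : (H1.card : ℝ) ≤ H.card := by exact_mod_cast card_le_card hH1H
    have e1 : ((R + 1 : ℕ) : ℝ) / D * (H1.card * q ^ (R + 1)) =
        (r * H1.card) * (q ^ R * q) / D := by rw [pow_succ]; ring
    rw [e1, div_le_iff₀ (by positivity)]
    have e2 : n * q / 8 * D = (d * n) * (q ^ R * q) := by
      rw [hD, ← hdq]; ring
    rw [e2]
    refine mul_le_mul_of_nonneg_right (le_trans ?_ hcard) (by positivity)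
    gcongr
  have hb3 : 128 * r ^ 3 ≤ b ^ 3 := by
    have h1 : (128 * r) ^ 3 ≤ b ^ 3 := by gcongr
    have h2 : 0 ≤ r ^ 3 := by positivity
    nlinarith
  have hr23 : r ^ 2 ≤ r ^ 3 := pow_le_pow_right₀ hr1 (by norm_num)
  have hb12 : ∀ a, 12 ≤ a → 1 / b ^ a ≤ q / b ^ 3 := by
    intro a ha
    have : q / b ^ 3 = 1 / b ^ 12 := by
      rw [hq, div_div, ← pow_add]
    rw [this]
    exact one_div_le_one_div_of_le (by positivity) (pow_le_pow_right₀ hb1 ha)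
  have t2 : ((n * (D0 * (D0 * ((R + 1) * ((R + 1) * 1)))) : ℕ) : ℝ) * q ^ (3 * R) ≤ n * q / 16 := by
    have e1 : ((n * (D0 * (D0 * ((R + 1) * ((R + 1) * 1)))) : ℕ) : ℝ) = n * (D0 ^ 2 * r ^ 2) := by
      rw [hrdef]; push_cast; ring
    have e3 : d ^ 2 * q ^ (3 * R) = 1 / b ^ (7 * R) := by
      rw [hd, hq, div_pow, one_pow, ← pow_mul, ← pow_mul, mul_one_div,
        div_eq_div_iff (by positivity) (by positivity), ← pow_add, one_mul]
      congr 1; ring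
    rw [e1]
    calc (n : ℝ) * (D0 ^ 2 * r ^ 2) * q ^ (3 * R) ≤ n * ((2 * d) ^ 2 * r ^ 2) * q ^ (3 * R) := by
          gcongr
      _ = n * (4 * r ^ 2) * (d ^ 2 * q ^ (3 * R)) := by ring
      _ ≤ n * (4 * r ^ 2) * (q / b ^ 3) := by
          rw [e3]
          exact mul_le_mul_of_nonneg_left (hb12 _ (by omega)) (by positivity)
      _ = n * q * (4 * r ^ 2 / b ^ 3) := by ring
      _ ≤ n * q * (1 / 16) := by
          refine mul_le_mul_of_nonneg_left ?_ (by positivity)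
          rw [div_le_div_iff₀ (by positivity) (by norm_num)]
          have : 0 ≤ r ^ 3 := by positivity
          linarith
      _ = n * q / 16 := by ring
  have t3 : ((n * (D0 * (D0 * ((R + 1) * (D0 * ((R + 1) * ((R + 1) * 1)))))) : ℕ) : ℝ) *
      q ^ (4 * R) ≤ n * q / 16 := by
    have e1 : ((n * (D0 * (D0 * ((R + 1) * (D0 * ((R + 1) * ((R + 1) * 1)))))) : ℕ) : ℝ) =
        n * (D0 ^ 3 * r ^ 3) := by
      rw [hrdef]; push_cast; ring
    have e3 : d ^ 3 * q ^ (4 * R) = 1 / b ^ (6 * R) := by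
      rw [hd, hq, div_pow, one_pow, ← pow_mul, ← pow_mul, mul_one_div,
        div_eq_div_iff (by positivity) (by positivity), ← pow_add, one_mul]
      congr 1; ring
    rw [e1]
    calc (n : ℝ) * (D0 ^ 3 * r ^ 3) * q ^ (4 * R) ≤ n * ((2 * d) ^ 3 * r ^ 3) * q ^ (4 * R) := by
          gcongr
      _ = n * (8 * r ^ 3) * (d ^ 3 * q ^ (4 * R)) := by ring
      _ ≤ n * (8 * r ^ 3) * (q / b ^ 3) := by
          rw [e3]
          exact mul_le_mul_of_nonneg_left (hb12 _ (by omega)) (by positivity)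
      _ = n * q * (8 * r ^ 3 / b ^ 3) := by ring
      _ ≤ n * q * (1 / 16) := by
          refine mul_le_mul_of_nonneg_left ?_ (by positivity)
          rw [div_le_div_iff₀ (by positivity) (by norm_num)]
          linarith
      _ = n * q / 16 := by ring
  have hAn : n * q / 4 ≤ A.card := by
    have : q * (n / 2) ≤ q * A1.card := mul_le_mul_of_nonneg_left hA1c hq0.le
    linarith
  obtain ⟨J, hJA, hJ, hJc⟩ := hnib (8 * b) (by linarith) n (H1.filter (· ⊆ A)) hAU A
    (fun E hE => (mem_filter.1 hE).2) (fun v hv => (hAd v hv).trans (by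
      rw [hD, mul_pow]
      have : (8 : ℝ) ≤ 8 ^ R := le_self_pow₀ (by norm_num) (by omega)
      gcongr))
  refine ⟨J, ?_, le_trans ?_ hJc⟩
  · intro E hE hEJ
    exact hJ E (mem_filter.2 ⟨mem_filter.2 ⟨hE, (hEJ.trans hJA).trans hAA1⟩, hEJ.trans hJA⟩) hEJ
  have hl0 : 0 ≤ Real.log b := Real.log_nonneg hb1
  have hl : Real.log b ^ ((R : ℝ)⁻¹) ≤ Real.log (8 * b) ^ ((R : ℝ)⁻¹) :=
    Real.rpow_le_rpow hl0 (Real.log_le_log hb0 (by linarith)) (by positivity)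
  have hL0 : 0 ≤ Real.log b ^ ((R : ℝ)⁻¹) := Real.rpow_nonneg hl0 _
  generalize Real.log b ^ ((R : ℝ)⁻¹) = L at hl hL0 ⊢
  generalize Real.log (8 * b) ^ ((R : ℝ)⁻¹) = L' at hl ⊢
  have hL0' : 0 ≤ L' := hL0.trans hl
  calc c / 32 * n * (L / b ^ 10) = c * L / (8 * b) * (n * q / 4) := by
        rw [hq]; field_simp; ring
    _ ≤ c * L' / (8 * b) * A.card := by gcongr

theorem final {R : ℕ} (hR : 2 ≤ R) : ∃ c : ℝ, 0 < c ∧ ∀ d : ℝ, 2 ≤ d →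
    ∀ (n : ℕ) (H : Finset (Finset (Fin n))), (∀ E ∈ H, E.card = R + 1) → Lin H →
    ((R + 1 : ℕ) : ℝ) * H.card ≤ d * n →
    ∃ I : Finset (Fin n), (∀ E ∈ H, ¬ E ⊆ I) ∧
      c * n * (Real.log d / d) ^ ((R : ℝ)⁻¹) ≤ I.card := by
  obtain ⟨c, hc, b0, hb0, hmain⟩ := main_b hR
  have hRpos : (0 : ℝ) < R := by positivity
  -- large d
  have hlarge : ∀ d : ℝ, b0 ^ (10 * R) ≤ d →
      ∀ (n : ℕ) (H : Finset (Finset (Fin n))), (∀ E ∈ H, E.card = R + 1) → Lin H →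
      ((R + 1 : ℕ) : ℝ) * H.card ≤ d * n →
      ∃ I : Finset (Fin n), (∀ E ∈ H, ¬ E ⊆ I) ∧
        c * (1 / (10 * R)) ^ ((R : ℝ)⁻¹) * n * (Real.log d / d) ^ ((R : ℝ)⁻¹) ≤ I.card := by
    intro d hd n H hr hL hcard
    have hd0 : 0 < d := lt_of_lt_of_le (by positivity) hd
    set b := d ^ (((10 * R : ℕ) : ℝ)⁻¹) with hb
    have hbd : b ^ (10 * R) = d := Real.rpow_inv_natCast_pow hd0.le (by omega)
    have hbpos : 0 < b := Real.rpow_pos_of_pos hd0 _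
    have hbb : b0 ≤ b := by
      refine le_of_pow_le_pow_left₀ (n := 10 * R) (by omega) hbpos.le ?_
      rw [hbd]; exact hd
    obtain ⟨I, hI, hIc⟩ := hmain b hbb n H hr hL (by rw [hbd]; exact hcard)
    refine ⟨I, hI, le_trans (le_of_eq ?_) hIc⟩
    have hlb : Real.log d = 10 * R * Real.log b := by
      rw [← hbd, Real.log_pow]; push_cast; ring
    have hl0 : 0 ≤ Real.log b := Real.log_nonneg (by linarith)
    have e1 : (Real.log d / d) ^ ((R : ℝ)⁻¹) =
        (10 * R : ℝ) ^ ((R : ℝ)⁻¹) * Real.log b ^ ((R : ℝ)⁻¹) / b ^ 10 := by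
      rw [Real.div_rpow (by rw [hlb]; positivity) hd0.le, hlb, Real.mul_rpow (by positivity) hl0]
      congr 1
      rw [← hbd, pow_mul, Real.pow_rpow_inv_natCast (by positivity) (by omega)]
    have e2 : (1 / (10 * R : ℝ)) ^ ((R : ℝ)⁻¹) * (10 * R : ℝ) ^ ((R : ℝ)⁻¹) = 1 := by
      rw [← Real.mul_rpow (by positivity) (by positivity), one_div_mul_cancel (by positivity),
        Real.one_rpow]
    rw [e1]
    linear_combination (c * n * (Real.log b ^ ((R : ℝ)⁻¹) / b ^ 10)) * e2
  set c1 := c * (1 / (10 * R)) ^ ((R : ℝ)⁻¹) with hc1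
  have hc10 : 0 < c1 := by rw [hc1]; positivity
  set d0 := b0 ^ (10 * R) with hd0
  have hd02 : 2 ≤ d0 := hb0.trans (le_self_pow₀ (by linarith) (by omega))
  set K := (Real.log d0 / d0) ^ ((R : ℝ)⁻¹) with hK
  have hK0 : 0 < K := Real.rpow_pos_of_pos
    (div_pos (Real.log_pos (by linarith)) (by linarith)) _
  refine ⟨min c1 (c1 * K), lt_min hc10 (by positivity), ?_⟩
  intro d hd n H hr hL hcard
  have hle1 : (Real.log d / d) ^ ((R : ℝ)⁻¹) ≤ 1 := by
    refine Real.rpow_le_one (div_nonneg (Real.log_nonneg (by linarith)) (by linarith)) ?_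
      (by positivity)
    rw [div_le_one (by linarith)]
    exact Real.log_le_self (by linarith)
  have hge0 : 0 ≤ (Real.log d / d) ^ ((R : ℝ)⁻¹) :=
    Real.rpow_nonneg (div_nonneg (Real.log_nonneg (by linarith)) (by linarith)) _
  by_cases h : d0 ≤ d
  · obtain ⟨I, hI, hIc⟩ := hlarge d h n H hr hL hcard
    refine ⟨I, hI, le_trans ?_ hIc⟩
    have := min_le_left c1 (c1 * K)
    gcongr
  · push Not at h
    obtain ⟨I, hI, hIc⟩ := hlarge d0 le_rfl n H hr hL (hcard.trans (by gcongr))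
    refine ⟨I, hI, le_trans ?_ hIc⟩
    rw [← hK]
    have := min_le_right c1 (c1 * K)
    calc min c1 (c1 * K) * n * (Real.log d / d) ^ ((R : ℝ)⁻¹) ≤ c1 * K * n * 1 := by gcongr
      _ = c1 * n * K := by ring

end DLR

/-- Duke–Lefmann–Rödl: for every fixed `r ≥ 3` there is `c > 0` such that every linear `r`-graph
on `n ≥ 1` vertices with average degree at most `d ≥ 2` has an independent set of size at least
`c n (log d / d)^(1/(r-1))`. -/
theorem stmt_3 (r : ℕ) (hr : 3 ≤ r) :
    ∃ c : ℝ, 0 < c ∧ ∀ d : ℝ, 2 ≤ d → ∀ n : ℕ, 1 ≤ n →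
      ∀ H : Finset (Finset (Fin n)),
        (∀ A ∈ H, A.card = r) →
        (∀ A ∈ H, ∀ B ∈ H, A ≠ B → (A ∩ B).card ≤ 1) →
        (r : ℝ) * H.card ≤ d * n →
        ∃ I : Finset (Fin n), (∀ A ∈ H, ¬ A ⊆ I) ∧
          c * n * (Real.log d / d) ^ ((1 : ℝ) / ((r : ℝ) - 1)) ≤ I.card := by
  obtain ⟨R, rfl⟩ : ∃ R, r = R + 1 := ⟨r - 1, by omega⟩
  obtain ⟨c, hc, h⟩ := DLR.final (R := R) (by omega)
  refine ⟨c, hc, fun d hd n _ H hu hl hcard => ?_⟩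
  obtain ⟨I, hI, hIc⟩ := h d hd n H hu (by
    intro E hE F hF hne x y hx hx' hy hy'
    exact Finset.card_le_one.1 (hl E hE F hF hne) x (Finset.mem_inter.2 ⟨hx, hx'⟩) y
      (Finset.mem_inter.2 ⟨hy, hy'⟩)) hcard
  refine ⟨I, hI, ?_⟩
  have : (1 : ℝ) / (((R + 1 : ℕ) : ℝ) - 1) = (R : ℝ)⁻¹ := by
    push_cast; rw [add_sub_cancel_right, one_div]
  rw [this]
  exact hIc
end

section
/- Let r ≥ 3, e ≥ 3, v ≥ r+1 be fixed integers with gcd(e-1, er-v) = 1, and for 2 ≤ i ≤ e-1 set f(i) = ⌈(i-1)(er-v)/(e-1)⌉. Then there exist a real ε > 0 and constants c₁, c₂ > 0 such that for all sufficiently large n there exists an r-graph H on vertex set [n] satisfying: (i) |H| ≥ c₁ · n^{(er-v)/(e-1) + ε}; (ii) the number of e-element subfamilies of H whose e edges have union containing at most v vertices (bad e-systems) is at most c₂ · n^{(er-v)/(e-1) + eε}; (iii) for each 2 ≤ i ≤ e-1, the union of any i distinct edges of H contains more than ir - f(i) vertices; (iv) any two distinct bad e-systems of H share at most one edge. -/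
open Finset

lemma sample_aux {V : Type*} [DecidableEq V] (F : Finset (Finset V)) (wt : Finset V → ℝ)
    (hw : ∀ S, 0 ≤ wt S) (m : ℕ) (hm : 1 ≤ m) : ∀ (k : ℕ) (E : Finset V), E.card = m + k →
    ∃ H ⊆ E, H.card = m ∧ ∑ S ∈ F with S ⊆ H, wt S ≤
      ∑ S ∈ F with S ⊆ E, wt S * ((m : ℝ) / E.card) ^ S.card := by
  intro k
  induction k with
  | zero =>
    intro E hE
    refine ⟨E, Subset.refl _, by simpa using hE, ?_⟩
    have : (m : ℝ) / E.card = 1 := by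
      rw [hE]; simp only [add_zero]; exact div_self (by norm_cast; omega)
    simp [this]
  | succ k ih =>
    intro E hE
    have hne : E.Nonempty := by rw [← card_pos]; omega
    have hm' : (1 : ℝ) ≤ m := by exact_mod_cast hm
    obtain ⟨x, hx, hxle⟩ : ∃ x ∈ E, ∑ S ∈ F with S ⊆ E.erase x, wt S * ((m : ℝ) / (m + k)) ^ S.card
        ≤ ∑ S ∈ F with S ⊆ E, wt S * ((m : ℝ) / E.card) ^ S.card := by
      apply exists_le_of_sum_le hne
      have h1 : ∀ x ∈ E, ∑ S ∈ F with S ⊆ E.erase x, wt S * ((m : ℝ) / (m + k)) ^ S.card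
          = ∑ S ∈ F with S ⊆ E, if x ∉ S then wt S * ((m : ℝ) / (m + k)) ^ S.card else 0 := by
        intro x hx
        rw [← sum_filter, filter_filter]
        congr 1
        ext S
        simp [subset_erase]
      rw [sum_congr rfl h1, sum_comm, sum_const, nsmul_eq_mul, mul_sum]
      apply sum_le_sum
      intro S hS
      have hSE := (mem_filter.1 hS).2
      rw [← sum_filter, sum_const, nsmul_eq_mul]
      have hc : #{a ∈ E | a ∉ S} = E.card - S.card := by
        rw [← card_sdiff_of_subset hSE]; congr 1; ext; simp
      have hle := card_le_card hSE
      rw [hc, Nat.cast_sub hle, hE]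
      push_cast
      set s := S.card
      have hk : (0:ℝ) ≤ k := by positivity
      have hb := one_add_mul_le_pow (a := -(1 / ((m:ℝ) + (k+1)))) (by
        have : 1 / ((m:ℝ) + (k+1)) ≤ 1 := by
          rw [div_le_one (by positivity)]; linarith
        linarith) s
      have e1 : 1 + -(1 / ((m:ℝ) + (k+1))) = (m + k) / (m + (k+1)) := by
        field_simp; ring
      have e2 : 1 + (s:ℝ) * -(1 / ((m:ℝ) + (k+1))) = (m + (k+1) - s) / (m + (k+1)) := by
        field_simp; ring
      rw [e1, e2, div_le_iff₀ (by positivity)] at hb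
      have e3 : ((m:ℝ) / (m + (k+1)))^s = ((m:ℝ) / (m + k))^s * ((m + k) / (m + (k+1)))^s := by
        rw [← mul_pow]; congr 1
        field_simp
      rw [e3]
      have := mul_le_mul_of_nonneg_left hb (mul_nonneg (hw S) (by positivity : 0 ≤ ((m:ℝ) / (m + k))^s))
      linarith
    obtain ⟨H, hH, hc, hs⟩ := ih (E.erase x) (by rw [card_erase_of_mem hx]; omega)
    refine ⟨H, hH.trans (erase_subset _ _), hc, hs.trans ?_⟩
    have : ((E.erase x).card : ℝ) = m + k := by
      rw [card_erase_of_mem hx, hE]; simp [← add_assoc]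
    rw [this]
    exact hxle

/-- families of `s` edges whose union has at most `w` vertices -/
def fam (r s : ℕ) (w : ℤ) (n : ℕ) : Finset (Finset (Finset (Fin n))) :=
  ((powersetCard r (univ : Finset (Fin n))).powersetCard s).filter
    (fun S => ((S.sup id).card : ℤ) ≤ w)

lemma fam_nat (r s w n : ℕ) (hs : 1 ≤ s) (hr : 1 ≤ r) :
    (fam r s w n).card ≤ 2 ^ (2 ^ w) * n ^ w := by
  have hsub : fam r s w n ⊆ (univ : Finset (Fin w → Fin n)).biUnion
      (fun g => (univ.image g).powerset.powerset) := by
    intro S hS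
    simp only [fam, mem_filter, mem_powersetCard] at hS
    obtain ⟨⟨hSE, hSc⟩, hSw⟩ := hS
    have hSw' : (S.sup id).card ≤ w := by exact_mod_cast hSw
    obtain ⟨A, hA⟩ : S.Nonempty := by rw [← card_pos]; omega
    have hAc := (mem_powersetCard.1 (hSE hA)).2
    obtain ⟨y, hy⟩ : A.Nonempty := by rw [← card_pos]; omega
    have hyS : y ∈ S.sup id := (le_sup (f := id) hA : A ≤ _) hy
    -- a surjection
    let g : Fin w → Fin n := fun i => if h : i.1 < (S.sup id).card then
      ((S.sup id).equivFin.symm ⟨i.1, h⟩).1 else y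
    have hg : S.sup id ⊆ univ.image g := by
      intro z hz
      rw [mem_image]
      refine ⟨⟨((S.sup id).equivFin ⟨z, hz⟩).1, lt_of_lt_of_le (Fin.is_lt _) hSw'⟩, mem_univ _, ?_⟩
      simp [g]
    rw [mem_biUnion]
    refine ⟨g, mem_univ _, ?_⟩
    rw [mem_powerset]
    intro B hB
    rw [mem_powerset]
    exact ((le_sup (f := id) hB : B ≤ _) : B ⊆ _).trans hg
  refine (card_le_card hsub).trans (card_biUnion_le.trans ?_)
  calc _ ≤ ∑ g : Fin w → Fin n, 2 ^ (2 ^ w) := by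
        apply sum_le_sum
        intro g _
        rw [card_powerset, card_powerset]
        have : (univ.image g).card ≤ w := by simpa using card_image_le (s := univ) (f := g)
        gcongr <;> norm_num
    _ = _ := by simp [mul_comm]

lemma fam_int (r s : ℕ) (w : ℤ) (hs : 1 ≤ s) (hr : 1 ≤ r) : ∃ C : ℝ, 0 < C ∧ ∀ n : ℕ,
    ((fam r s w n).card : ℝ) ≤ C * (n : ℝ) ^ (w : ℝ) := by
  rcases lt_or_ge w 0 with h | h
  · refine ⟨1, one_pos, fun n => ?_⟩
    have : fam r s w n = ∅ := by
      apply filter_eq_empty_iff.2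
      intro S _; push Not; omega
    rw [this]; simp; positivity
  · obtain ⟨k, rfl⟩ := Int.eq_ofNat_of_zero_le h
    refine ⟨2 ^ (2 ^ k), by positivity, fun n => ?_⟩
    have := fam_nat r s k n hs hr
    simp only [Int.cast_natCast, Real.rpow_natCast]
    exact_mod_cast this

lemma sum_biUnion_le' {α β : Type*} [DecidableEq β] [DecidableEq α] (P : Finset α)
    (t : α → Finset β) (f : β → ℝ) (hf : ∀ b, 0 ≤ f b) :
    ∑ b ∈ P.biUnion t, f b ≤ ∑ a ∈ P, ∑ b ∈ t a, f b := by
  induction P using Finset.induction_on with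
  | empty => simp
  | insert a P ha ih =>
    rw [biUnion_insert, sum_insert ha]
    have h1 := sum_union_inter (s₁ := t a) (s₂ := P.biUnion t) (f := f)
    have h2 : 0 ≤ ∑ b ∈ t a ∩ P.biUnion t, f b := sum_nonneg fun b _ => hf b
    linarith

lemma deletion {V : Type*} [DecidableEq V] (E : Finset V) (A B : Finset (Finset V)) (m : ℕ)
    (hm : 1 ≤ m) (hmE : m ≤ E.card) (D : ℝ) (hD : 0 < D)
    (hA : ∑ S ∈ A, ((m : ℝ) / E.card) ^ S.card ≤ m / 4)
    (hB : ∑ S ∈ B, ((m : ℝ) / E.card) ^ S.card ≤ D / 2)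
    (hne : ∀ S ∈ A, S.Nonempty) :
    ∃ H ⊆ E, (m : ℝ) / 2 ≤ H.card ∧ (∀ S ∈ A, ¬ S ⊆ H) ∧ (#{S ∈ B | S ⊆ H} : ℝ) ≤ D := by
  have hm' : (0 : ℝ) < m := by exact_mod_cast hm
  obtain ⟨k, hk⟩ := Nat.exists_eq_add_of_le hmE
  obtain ⟨H, hHE, hHc, hH⟩ := sample_aux (A ∪ B)
    (fun S => (if S ∈ A then 2 / (m : ℝ) else 0) + (if S ∈ B then 1 / D else 0))
    (fun S => by positivity) m hm k E hk
  have hl : ∑ S ∈ A ∪ B with S ⊆ H,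
      ((if S ∈ A then 2 / (m : ℝ) else 0) + (if S ∈ B then 1 / D else 0))
      = #{S ∈ A | S ⊆ H} * (2 / (m : ℝ)) + #{S ∈ B | S ⊆ H} * (1 / D) := by
    rw [sum_add_distrib, ← sum_filter, ← sum_filter, sum_const, sum_const, nsmul_eq_mul,
      nsmul_eq_mul]
    congr 4
    · ext S; simp only [mem_filter, mem_union]; tauto
    · ext S; simp only [mem_filter, mem_union]; tauto
  have hr : ∑ S ∈ A ∪ B with S ⊆ E,
      ((if S ∈ A then 2 / (m : ℝ) else 0) + (if S ∈ B then 1 / D else 0)) *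
        ((m : ℝ) / E.card) ^ S.card
      ≤ 2 / (m : ℝ) * (m / 4) + 1 / D * (D / 2) := by
    simp only [add_mul, ite_mul, zero_mul]
    rw [sum_add_distrib, ← sum_filter, ← sum_filter, ← mul_sum, ← mul_sum]
    gcongr
    · refine le_trans (sum_le_sum_of_subset_of_nonneg (t := A) ?_ ?_) hA
      · intro S; simp
      · intros; positivity
    · refine le_trans (sum_le_sum_of_subset_of_nonneg (t := B) ?_ ?_) hB
      · intro S; simp
      · intros; positivity
  rw [hl] at hH
  have h1 : 2 / (m : ℝ) * (m / 4) + 1 / D * (D / 2) = 1 := by field_simp; norm_num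
  have h2 := hH.trans (hr.trans h1.le)
  have hXA : (#{S ∈ A | S ⊆ H} : ℝ) ≤ m / 2 := by
    have : (#{S ∈ A | S ⊆ H} : ℝ) * (2 / (m : ℝ)) ≤ 1 := by
      have : 0 ≤ (#{S ∈ B | S ⊆ H} : ℝ) * (1 / D) := by positivity
      linarith
    rw [mul_div_assoc', div_le_one hm'] at this
    linarith
  have hXB : (#{S ∈ B | S ⊆ H} : ℝ) ≤ D := by
    have : (#{S ∈ B | S ⊆ H} : ℝ) * (1 / D) ≤ 1 := by
      have : 0 ≤ (#{S ∈ A | S ⊆ H} : ℝ) * (2 / (m : ℝ)) := by positivity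
      linarith
    rw [mul_div_assoc', div_le_one hD] at this
    linarith
  have hne' : ∀ S : Finset V, ∃ x, S ∈ A → x ∈ S := by
    have hE0 : E.Nonempty := by rw [← card_pos]; omega
    intro S
    by_cases hS : S ∈ A
    · obtain ⟨x, hx⟩ := hne S hS
      exact ⟨x, fun _ => hx⟩
    · exact ⟨hE0.choose, fun h => absurd h hS⟩
  choose g hg using hne'
  set R := ({S ∈ A | S ⊆ H}).image g with hR
  refine ⟨H \ R, sdiff_subset.trans hHE, ?_, ?_, ?_⟩
  · have c1 : R.card ≤ #{S ∈ A | S ⊆ H} := card_image_le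
    have c2 : H.card ≤ (H \ R).card + R.card := by
      have := card_le_card (show H ⊆ (H \ R) ∪ R by intro x hx; simp [hx])
      exact this.trans (card_union_le _ _)
    have c3 : (m : ℝ) ≤ (H \ R).card + #{S ∈ A | S ⊆ H} := by
      exact_mod_cast hHc ▸ c2.trans (by omega)
    linarith
  · intro S hS hSH
    have := hSH (hg S hS)
    rw [mem_sdiff] at this
    exact this.2 (mem_image_of_mem g (mem_filter.2 ⟨hS, hSH.trans sdiff_subset⟩))
  · refine le_trans ?_ hXB
    gcongr with S hS
    exact sdiff_subset

open Filter Topology in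
lemma rpow_small (C b a : ℝ) (h : b < a) :
    Tendsto (fun n : ℕ => C * (n : ℝ) ^ (b - a)) atTop (𝓝 0) := by
  have := ((tendsto_rpow_neg_atTop (sub_pos.2 h)).comp tendsto_natCast_atTop_atTop).const_mul C
  simpa [Function.comp_def] using this

lemma choose_lower (r n : ℕ) (h : 2 * r ≤ n) :
    (n : ℝ) ^ r ≤ (2 ^ r * r.factorial) * (n.choose r : ℝ) := by
  have h1 : (n + 1 - r) ^ r ≤ r.factorial * n.choose r := by
    rw [← Nat.descFactorial_eq_factorial_mul_choose]
    exact Nat.pow_sub_le_descFactorial n r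
  have h2 : n ^ r ≤ 2 ^ r * (n + 1 - r) ^ r := by
    rw [← mul_pow]; gcongr; omega
  have h3 : n ^ r ≤ 2 ^ r * r.factorial * n.choose r := by
    rw [mul_assoc]; exact h2.trans (by gcongr)
  exact_mod_cast h3

open Filter Topology in
lemma core (r e v : ℕ) (hr : 1 ≤ r) (he : 1 ≤ e) (a : ℝ) (ha : 0 < a) (har : a < r)
    (P : Finset (ℕ × ℤ))
    (hP : ∀ q ∈ P, 1 ≤ q.1 ∧ (q.2 : ℝ) + q.1 * (a - r) < a) :
    ∃ c₂ : ℝ, 0 < c₂ ∧ ∃ N : ℕ, ∀ n : ℕ, N ≤ n →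
      ∃ H : Finset (Finset (Fin n)), (∀ A ∈ H, A.card = r) ∧
        1 / 2 * (n : ℝ) ^ a ≤ H.card ∧
        (((H.powersetCard e).filter (fun S => (S.sup id).card ≤ v)).card : ℝ)
          ≤ c₂ * (n : ℝ) ^ (v + e * (a - r)) ∧
        ∀ q ∈ P, ∀ S ⊆ H, S.card = q.1 → q.2 < ((S.sup id).card : ℤ) := by
  have hfam : ∀ q : ℕ × ℤ, ∃ C : ℝ, 0 < C ∧ (1 ≤ q.1 → ∀ n : ℕ,
      ((fam r q.1 q.2 n).card : ℝ) ≤ C * (n : ℝ) ^ (q.2 : ℝ)) := by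
    intro q
    by_cases h : 1 ≤ q.1
    · obtain ⟨C, h1, h2⟩ := fam_int r q.1 q.2 h hr
      exact ⟨C, h1, fun _ => h2⟩
    · exact ⟨1, one_pos, fun h' => absurd h' h⟩
  choose C hC0 hC using hfam
  set K : ℝ := 2 * (2 ^ r * r.factorial) with hK
  have hK0 : 0 < K := by positivity
  refine ⟨2 * (C (e, v) * K ^ e), by have := hC0 (e, v); positivity, ?_⟩
  have ev1 : ∀ᶠ n : ℕ in atTop, K * (n : ℝ) ^ (a - r) < 1 :=
    (rpow_small K a r har).eventually_lt_const one_pos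
  have ev2 : ∀ᶠ n : ℕ in atTop, ∑ q ∈ P, (C q * K ^ q.1) *
      (n : ℝ) ^ (((q.2 : ℝ) + q.1 * (a - r)) - a) < 1 / 4 := by
    have : Tendsto (fun n : ℕ => ∑ q ∈ P, (C q * K ^ q.1) *
      (n : ℝ) ^ (((q.2 : ℝ) + q.1 * (a - r)) - a)) atTop (𝓝 (∑ q ∈ P, 0)) :=
      tendsto_finsetSum _ fun q hq => rpow_small _ _ _ (hP q hq).2
    rw [sum_const_zero] at this
    exact this.eventually_lt_const (by norm_num)
  obtain ⟨N, hN⟩ := eventually_atTop.1 (ev1.and (ev2.and (eventually_ge_atTop (2 * r + 1))))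
  refine ⟨N, fun n hn => ?_⟩
  obtain ⟨h1, h2, h3⟩ := hN n hn
  have hn0 : (0 : ℝ) < n := by exact_mod_cast (by omega : 0 < n)
  have hn1 : (1 : ℝ) ≤ n := by exact_mod_cast (by omega : 1 ≤ n)
  have hna : 1 ≤ (n : ℝ) ^ a := Real.one_le_rpow hn1 ha.le
  set m := ⌈(n : ℝ) ^ a⌉₊ with hm
  have hm1 : (n : ℝ) ^ a ≤ m := Nat.le_ceil _
  have hm2 : (m : ℝ) ≤ 2 * (n : ℝ) ^ a := by
    have := Nat.ceil_lt_add_one (a := (n : ℝ) ^ a) (by positivity)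
    linarith
  set E := powersetCard r (univ : Finset (Fin n)) with hE
  have hEc : E.card = n.choose r := by simp [hE]
  have hch := choose_lower r n (by omega)
  have hEpos : (0 : ℝ) < E.card := by
    rw [hEc]; exact_mod_cast Nat.choose_pos (by omega : r ≤ n)
  have hp : (m : ℝ) / E.card ≤ K * (n : ℝ) ^ (a - r) := by
    rw [div_le_iff₀ hEpos, hEc, Real.rpow_sub hn0, Real.rpow_natCast, mul_div_assoc', div_mul_eq_mul_div,
      le_div_iff₀ (by positivity)]
    calc (m : ℝ) * n ^ r ≤ (2 * (n : ℝ) ^ a) * ((2 ^ r * r.factorial) * (n.choose r : ℝ)) := by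
          gcongr
      _ = _ := by rw [hK]; ring
  have hp0 : 0 ≤ (m : ℝ) / E.card := by positivity
  have key : ∀ q : ℕ × ℤ, 1 ≤ q.1 → ∑ S ∈ fam r q.1 q.2 n, ((m : ℝ) / E.card) ^ S.card
      ≤ (C q * K ^ q.1) * (n : ℝ) ^ ((q.2 : ℝ) + q.1 * (a - r)) := by
    intro q hq
    calc ∑ S ∈ fam r q.1 q.2 n, ((m : ℝ) / E.card) ^ S.card
        = ∑ S ∈ fam r q.1 q.2 n, ((m : ℝ) / E.card) ^ q.1 := by
          apply sum_congr rfl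
          intro S hS
          rw [fam, mem_filter, mem_powersetCard] at hS
          rw [hS.1.2]
      _ = (fam r q.1 q.2 n).card * ((m : ℝ) / E.card) ^ q.1 := by
          rw [sum_const, nsmul_eq_mul]
      _ ≤ (C q * (n : ℝ) ^ (q.2 : ℝ)) * (K * (n : ℝ) ^ (a - r)) ^ q.1 := by
          have := hC q hq n
          have := hC0 q
          have : 0 ≤ C q * (n : ℝ) ^ (q.2 : ℝ) := by positivity
          gcongr
      _ = _ := by
          rw [Real.rpow_add hn0, mul_pow, mul_comm (q.1 : ℝ), Real.rpow_mul hn0.le,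
            Real.rpow_natCast]
          ring
  have hCe := hC0 (e, v)
  obtain ⟨H, hHE, hHc, hHA, hHB⟩ := deletion E (P.biUnion fun q => fam r q.1 q.2 n) (fam r e v n) m
    (by exact_mod_cast hna.trans hm1)
    (by
      have := hp.trans h1.le
      rw [div_le_one hEpos] at this
      exact_mod_cast this)
    (2 * (C (e, v) * K ^ e) * (n : ℝ) ^ (v + e * (a - r))) (by positivity)
    (by
      calc _ ≤ ∑ q ∈ P, ∑ S ∈ fam r q.1 q.2 n, ((m : ℝ) / E.card) ^ S.card := by
            exact sum_biUnion_le' _ _ _ (fun S => by positivity)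
        _ ≤ ∑ q ∈ P, (C q * K ^ q.1) * (n : ℝ) ^ ((q.2 : ℝ) + q.1 * (a - r)) :=
            sum_le_sum fun q hq => key q (hP q hq).1
        _ = (∑ q ∈ P, (C q * K ^ q.1) * (n : ℝ) ^ (((q.2 : ℝ) + q.1 * (a - r)) - a))
              * (n : ℝ) ^ a := by
            rw [sum_mul]
            apply sum_congr rfl
            intro q _
            rw [mul_assoc (C q * K ^ q.1), ← Real.rpow_add hn0, sub_add_cancel]
        _ ≤ 1 / 4 * (n : ℝ) ^ a := by gcongr
        _ ≤ m / 4 := by linarith)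
    (by
      have := key (e, v) he
      simp only [Int.cast_natCast] at this
      linarith)
    (by
      intro S hS
      rw [mem_biUnion] at hS
      obtain ⟨q, hq, hS⟩ := hS
      rw [fam, mem_filter, mem_powersetCard] at hS
      rw [← card_pos, hS.1.2]
      exact (hP q hq).1)
  refine ⟨H, fun A hA => (mem_powersetCard.1 (hHE hA)).2, by linarith, ?_, ?_⟩
  · refine le_trans ?_ hHB
    norm_cast
    apply card_le_card
    intro S hS
    simp only [mem_filter, mem_powersetCard] at hS
    simp only [mem_filter, fam, mem_powersetCard]
    exact ⟨⟨⟨hS.1.1.trans hHE, hS.1.2⟩, by exact_mod_cast hS.2⟩, hS.1.1⟩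
  · intro q hq S hS hSc
    by_contra hcon
    push Not at hcon
    refine hHA S (mem_biUnion.2 ⟨q, hq, ?_⟩) hS
    simp only [mem_filter, fam, mem_powersetCard]
    exact ⟨⟨hS.trans hHE, hSc⟩, hcon⟩

lemma ceil_facts (d k j : ℤ) (hj : 1 ≤ j) (hjd : j < d) (hg : Int.gcd d k = 1) :
    j * k + 1 ≤ d * ⌈((j : ℚ) * k) / d⌉ ∧ d * (⌈((j : ℚ) * k) / d⌉ - 1) + 1 ≤ j * k := by
  set F := ⌈((j : ℚ) * k) / d⌉ with hF
  have hd : (0 : ℚ) < d := by exact_mod_cast (by omega : 0 < d)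
  have h1 : ((j : ℚ) * k) / d ≤ F := Int.le_ceil _
  have h2 : (F : ℚ) < ((j : ℚ) * k) / d + 1 := Int.ceil_lt_add_one _
  rw [div_le_iff₀ hd] at h1
  rw [← sub_lt_iff_lt_add, lt_div_iff₀ hd] at h2
  have h1' : j * k ≤ F * d := by exact_mod_cast h1
  have h2' : (F - 1) * d < j * k := by exact_mod_cast h2
  have h3 : j * k ≠ F * d := by
    intro h
    have hdvd : d ∣ j * k := ⟨F, by rw [h, mul_comm]⟩
    have : d ∣ j := Int.dvd_of_dvd_mul_left_of_gcd_one hdvd hg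
    have := Int.le_of_dvd (by omega) this
    omega
  refine ⟨?_, ?_⟩
  · rw [mul_comm d]; omega
  · rw [mul_comm d]; omega

/-- Key step in the proof of the main theorem: with `f(i) = ⌈(i-1)(er-v)/(e-1)⌉`, there are
`ε > 0` and constants `c₁, c₂ > 0` such that for all large `n` there is an `r`-graph `H` on `[n]`
with (i) `|H| ≥ c₁ n^((er-v)/(e-1)+ε)`; (ii) at most `c₂ n^((er-v)/(e-1)+eε)` bad `e`-systems;
(iii) any `i` distinct edges (`2 ≤ i ≤ e-1`) span more than `ir - f(i)` vertices; and
(iv) any two distinct bad `e`-systems share at most one edge. -/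
theorem stmt_6 (r e v : ℕ) (hr : 3 ≤ r) (he : 3 ≤ e) (hv : r + 1 ≤ v)
    (hgcd : Int.gcd ((e : ℤ) - 1) ((e : ℤ) * r - v) = 1) :
    ∃ ε : ℝ, 0 < ε ∧ ∃ c₁ c₂ : ℝ, 0 < c₁ ∧ 0 < c₂ ∧ ∃ N : ℕ, ∀ n : ℕ, N ≤ n →
      ∃ H : Finset (Finset (Fin n)),
        (∀ A ∈ H, A.card = r) ∧
        -- (i)
        c₁ * (n : ℝ) ^ (((e : ℝ) * r - v) / ((e : ℝ) - 1) + ε) ≤ H.card ∧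
        -- (ii)
        (((H.powersetCard e).filter (fun S => (S.sup id).card ≤ v)).card : ℝ)
          ≤ c₂ * (n : ℝ) ^ (((e : ℝ) * r - v) / ((e : ℝ) - 1) + e * ε) ∧
        -- (iii)
        (∀ i : ℕ, 2 ≤ i → i ≤ e - 1 → ∀ S ⊆ H, S.card = i →
          (i : ℤ) * r - ⌈(((i : ℚ) - 1) * ((e : ℚ) * r - v)) / ((e : ℚ) - 1)⌉
            < ((S.sup id).card : ℤ)) ∧
        -- (iv)
        (∀ S ⊆ H, ∀ T ⊆ H, S.card = e → T.card = e →
          (S.sup id).card ≤ v → (T.sup id).card ≤ v → S ≠ T → (S ∩ T).card ≤ 1) := by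
  set k : ℤ := (e : ℤ) * r - v with hk
  have heR : (3 : ℝ) ≤ e := by exact_mod_cast he
  have hd0 : (0 : ℝ) < (e : ℝ) - 1 := by linarith
  have hkR : (k : ℝ) = (e : ℝ) * r - v := by rw [hk]; push_cast; ring
  have hkQ : (k : ℚ) = (e : ℚ) * r - v := by rw [hk]; push_cast; ring
  have hk0 : k ≠ 0 := by
    intro h
    rw [h, Int.gcd_zero_right] at hgcd
    omega
  rcases lt_or_gt_of_ne hk0 with hneg | hpos
  · -- degenerate case: a single edge
    refine ⟨1 / ((e : ℝ) - 1), by positivity, 1, 1, one_pos, one_pos, r, fun n hn => ?_⟩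
    have hn1 : (1 : ℝ) ≤ n := by exact_mod_cast (by omega : 1 ≤ n)
    obtain ⟨A, -, hA⟩ := exists_subset_card_eq (s := (univ : Finset (Fin n))) (n := r) (by simpa using hn)
    have hsmall : ∀ S : Finset (Finset (Fin n)), S ⊆ {A} → S.card ≤ 1 := fun S hS => by
      simpa using card_le_card hS
    refine ⟨{A}, by simpa using hA, ?_, ?_, ?_, ?_⟩
    · have : (k : ℝ) ≤ -1 := by exact_mod_cast (by omega : k ≤ -1)
      simp only [one_mul, card_singleton, Nat.cast_one]
      apply Real.rpow_le_one_of_one_le_of_nonpos hn1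
      rw [← hkR, ← add_div]
      exact div_nonpos_of_nonpos_of_nonneg (by linarith) hd0.le
    · have : powersetCard e ({A} : Finset (Finset (Fin n))) = ∅ := by
        rw [powersetCard_eq_empty]; simp; omega
      rw [this]; simp; positivity
    · intro i hi _ S hS hSc
      have := hsmall S hS
      omega
    · intro S hS T _ hSc
      have := hsmall S hS
      omega
  · set α : ℝ := ((e : ℝ) * r - v) / ((e : ℝ) - 1) with hα
    have hdα : ((e : ℝ) - 1) * α = k := by rw [hα, hkR]; field_simp
    set ε : ℝ := 1 / (4 * (e : ℝ) ^ 2) with hε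
    have hε0 : 0 < ε := by positivity
    have hε4 : (e : ℝ) ^ 2 * ε = 1 / 4 := by rw [hε]; field_simp
    have hkpos : (1 : ℝ) ≤ k := by exact_mod_cast hpos
    have hα0 : 0 < α := by
      rw [hα, ← hkR]; positivity
    have hsl : ∀ t : ℝ, t ≤ 2 * e → ((e : ℝ) - 1) * (t * ε) < 1 := by
      intro t ht
      have h1 : ((e : ℝ) - 1) * (t * ε) ≤ ((e : ℝ) - 1) * (2 * e * ε) := by gcongr
      nlinarith
    have har : α + ε < r := by
      have h1 : ((e : ℝ) - 1) * (1 * ε) < 1 := hsl 1 (by linarith)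
      have h2 : (r : ℝ) + 1 ≤ v := by exact_mod_cast hv
      have h3 : ((e : ℝ) - 1) * (α + ε) < ((e : ℝ) - 1) * r := by
        rw [mul_add, hdα, hkR]; linarith
      exact lt_of_mul_lt_mul_left h3 hd0.le
    let F : ℕ → ℤ := fun i => ⌈(((i : ℚ) - 1) * ((e : ℚ) * r - v)) / ((e : ℚ) - 1)⌉
    have hF : ∀ i : ℕ, 2 ≤ i → i ≤ e - 1 →
        ((i : ℝ) - 1) * k + 1 ≤ ((e : ℝ) - 1) * F i ∧
        ((e : ℝ) - 1) * (F i - 1) + 1 ≤ ((i : ℝ) - 1) * k := by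
      intro i hi hie
      have := ceil_facts ((e : ℤ) - 1) k ((i : ℤ) - 1) (by omega) (by omega) hgcd
      push_cast at this
      rw [hkQ] at this
      change ((i : ℤ) - 1) * k + 1 ≤ ((e : ℤ) - 1) * F i ∧
        ((e : ℤ) - 1) * (F i - 1) + 1 ≤ ((i : ℤ) - 1) * k at this
      exact ⟨by exact_mod_cast this.1, by exact_mod_cast this.2⟩
    let P : Finset (ℕ × ℤ) := (Icc 2 (e - 1)).image (fun i => (i, (i : ℤ) * r - F i)) ∪
      (Icc 2 (e - 1)).image (fun i => (2 * e - i, 2 * (v : ℤ) - i * r + F i - 1))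
    have hP : ∀ q ∈ P, 1 ≤ q.1 ∧ (q.2 : ℝ) + q.1 * (α + ε - r) < α + ε := by
      intro q hq
      simp only [P, mem_union, mem_image, mem_Icc] at hq
      rcases hq with ⟨i, ⟨hi, hie⟩, rfl⟩ | ⟨i, ⟨hi, hie⟩, rfl⟩
      · refine ⟨by dsimp only; omega, ?_⟩
        have hiR : (i : ℝ) ≤ e := by exact_mod_cast (by omega : i ≤ e)
        have h1 := (hF i hi hie).1
        have h2 := hsl ((i : ℝ) - 1) (by linarith)
        push_cast
        apply lt_of_mul_lt_mul_left _ hd0.le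
        have e1 : ((i : ℝ) - 1) * k = ((e : ℝ) - 1) * (((i : ℝ) - 1) * α) := by
          rw [← hdα]; ring
        rw [e1] at h1
        linarith
      · refine ⟨by dsimp only; omega, ?_⟩
        have hi0 : (2 : ℝ) ≤ i := by exact_mod_cast hi
        have h1 := (hF i hi hie).2
        have h2 := hsl (2 * (e : ℝ) - i - 1) (by linarith)
        rw [Nat.cast_sub (by omega)]
        push_cast
        apply lt_of_mul_lt_mul_left _ hd0.le
        have e1 : ((i : ℝ) - 1) * k = ((e : ℝ) - 1) * (((i : ℝ) - 1) * α) := by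
          rw [← hdα]; ring
        rw [e1] at h1
        have e2 : ((e : ℝ) - 1) * v = ((e : ℝ) - 1) * (e * r - (e - 1) * α) := by
          rw [hdα, hkR]; ring
        linarith
    obtain ⟨c₂, hc₂, N, hN⟩ := core r e v (by omega) (by omega) (α + ε) (by linarith) har P hP
    refine ⟨ε, hε0, 1 / 2, c₂, by norm_num, hc₂, N, fun n hn => ?_⟩
    obtain ⟨H, hH1, hH2, hH3, hH4⟩ := hN n hn
    have hiii : ∀ i : ℕ, 2 ≤ i → i ≤ e - 1 → ∀ S ⊆ H, S.card = i →
          (i : ℤ) * r - F i < ((S.sup id).card : ℤ) := by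
      intro i hi hie S hS hSc
      exact hH4 (i, (i : ℤ) * r - F i)
        (mem_union_left _ (mem_image_of_mem _ (mem_Icc.2 ⟨hi, hie⟩))) S hS hSc
    refine ⟨H, hH1, hH2, ?_, hiii, ?_⟩
    · have : α + e * ε = v + e * (α + ε - r) := by linarith
      rw [this]; exact hH3
    · intro S hS T hT hSc hTc hSv hTv hne
      by_contra hcon
      push Not at hcon
      have hlt : (S ∩ T).card < e := by
        by_contra h
        push Not at h
        have h1 : S ∩ T = S := eq_of_subset_of_card_le inter_subset_left (by omega)
        have h2 : S ∩ T = T := eq_of_subset_of_card_le inter_subset_right (by omega)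
        exact hne (h1.symm.trans h2)
      set j := (S ∩ T).card with hj
      have h3 := hiii j (by omega) (by omega) (S ∩ T) (inter_subset_left.trans hS) rfl
      have hU : (S ∪ T).card = 2 * e - j := by
        have := card_union_add_card_inter S T
        omega
      have h4 := hH4 (2 * e - j, 2 * (v : ℤ) - j * r + F j - 1)
        (mem_union_right _ (mem_image_of_mem (fun i : ℕ => (2 * e - i, 2 * (v : ℤ) - i * r + F i - 1))
          (mem_Icc.2 ⟨by omega, by omega⟩))) (S ∪ T) (union_subset hS hT) hU
      have h5 := card_union_add_card_inter (S.sup id) (T.sup id)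
      have h6 : ((S ∩ T).sup id).card ≤ (S.sup id ∩ T.sup id).card := by
        apply card_le_card
        apply subset_inter
        · exact sup_mono inter_subset_left
        · exact sup_mono inter_subset_right
      rw [sup_union, sup_eq_union] at h4
      dsimp only at h4
      omega
end
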